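/- Assume G ≅ C_{n1} ⊕ … ⊕ C_{nr} with 1 < n1 | … | nr and D(G) ≥ 4, and suppose r ≥ ⌊nr/2⌋ + 1. If nr is a prime power, then K(G, r−1) = 1 + (n1 − 1)(r−1)/n1 < r. -/

import Mathlib

/- Common definitions: zero-sum sequences over a finite abelian group,
   sets of lengths, the system of sets of lengths, the Davenport constant,
   sets of distances, elasticities, AAPs, Δ₁(G), ρ(G,d,k), ρ(G,d), ρ*(G,d),
   cross numbers, K(G₀), K(G,d), LCN-sets, Δ*(G). -/

open scoped Classical

section Defs

variable {G : Type*} [AddCommGroup G]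

/-- The support of a sequence (multiset) over `G`. -/
def suppSet (A : Multiset G) : Set G := {g | g ∈ A}

/-- `A` is a minimal zero-sum sequence (an atom of `𝓑(G₀)`) over `G₀ ⊆ G`:
a nontrivial zero-sum sequence with terms in `G₀` such that every proper
nontrivial subsequence has nonzero sum. -/
def IsMinZeroSum (G0 : Set G) (A : Multiset G) : Prop :=
  A ≠ 0 ∧ (∀ g ∈ A, g ∈ G0) ∧ A.sum = 0 ∧
    ∀ T : Multiset G, T ≤ A → T.sum = 0 → T = 0 ∨ T = A

/-- `B` is a zero-sum sequence over `G₀ ⊆ G` (an element of `𝓑(G₀)`). -/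
def IsZeroSumSeq (G0 : Set G) (B : Multiset G) : Prop :=
  (∀ g ∈ B, g ∈ G0) ∧ B.sum = 0

/-- The set of lengths `L(B)` of a zero-sum sequence `B` over `G₀`:
all `k` such that `B` is a product of `k` atoms of `𝓑(G₀)`.
(For the trivial sequence this is `{0}`.) -/
def lengthSet (G0 : Set G) (B : Multiset G) : Set ℕ :=
  {k | ∃ U : Fin k → Multiset G, (∀ i, IsMinZeroSum G0 (U i)) ∧ B = ∑ i, U i}

/-- The system of sets of lengths `𝓛(G₀)`. -/
def systemL (G0 : Set G) : Set (Set ℕ) :=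
  {L | ∃ B : Multiset G, IsZeroSumSeq G0 B ∧ L = lengthSet G0 B}

/-- The Davenport constant `D(G)`: the maximal length of a minimal zero-sum
sequence over `G`. -/
noncomputable def davenport (G : Type*) [AddCommGroup G] : ℕ :=
  sSup {m | ∃ A : Multiset G, IsMinZeroSum (Set.univ : Set G) A ∧ Multiset.card A = m}

/-- The set of successive distances `Δ(L)` of a set `L ⊆ ℕ`. -/
def deltaOf (L : Set ℕ) : Set ℕ :=
  {d | 0 < d ∧ ∃ a, a ∈ L ∧ a + d ∈ L ∧ ∀ c ∈ L, ¬(a < c ∧ c < a + d)}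

/-- `Δ(G₀) = ⋃_{L ∈ 𝓛(G₀)} Δ(L)`. -/
def deltaG0 (G0 : Set G) : Set ℕ := ⋃ L ∈ systemL G0, deltaOf L

/-- `Δ*(G) = {min Δ(G₀) : G₀ ⊆ G with Δ(G₀) ≠ ∅}`. -/
def deltaStar (G : Type*) [AddCommGroup G] : Set ℕ :=
  {d | ∃ G0 : Set G, deltaG0 G0 ≠ ∅ ∧ d = sInf (deltaG0 G0)}

/-- The elasticity `ρ(L) = max L / min L` of a (finite) set `L ⊆ ℕ`,
with the convention `ρ({0}) = 1`. -/
noncomputable def rhoL (L : Set ℕ) : ℝ :=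
  if sInf L = 0 then 1 else ((sSup L : ℕ) : ℝ) / ((sInf L : ℕ) : ℝ)

/-- The elasticity `ρ(G₀) = sup {ρ(L) : L ∈ 𝓛(G₀)}`. -/
noncomputable def rhoG0 (G0 : Set G) : ℝ := sSup (rhoL '' systemL G0)

/-- `L` (a set of naturals) is an almost arithmetical progression (AAP)
with difference `d`, length `ℓ` and bound `M`:
`L = y + (L' ∪ {0, d, …, ℓd} ∪ L'') ⊆ y + dℤ` with `L' ⊆ [−M, −1]` and
`L'' ⊆ ℓd + [1, M]`. -/
def IsAAP (L : Set ℕ) (d ℓ M : ℕ) : Prop :=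
  ∃ (y : ℤ) (L1 L2 : Set ℤ),
    L1 ⊆ Set.Icc (-(M : ℤ)) (-1) ∧
    L2 ⊆ Set.Icc ((ℓ : ℤ) * d + 1) ((ℓ : ℤ) * d + M) ∧
    ((fun x : ℕ => (x : ℤ)) '' L) =
      (fun x => y + x) '' (L1 ∪ (fun i : ℤ => (d : ℤ) * i) '' Set.Icc (0 : ℤ) (ℓ : ℤ) ∪ L2) ∧
    (∀ x ∈ L, (d : ℤ) ∣ ((x : ℤ) - y))

/-- `Δ₁(G)`: the set of `d ∈ ℕ` such that for every `k` there is some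
`L ∈ 𝓛(G)` which is an AAP with difference `d` and length at least `k`. -/
def delta1 (G : Type*) [AddCommGroup G] : Set ℕ :=
  {d | 0 < d ∧ ∀ k : ℕ, ∃ L ∈ systemL (Set.univ : Set G), ∃ ℓ ≥ k, ∃ M : ℕ, IsAAP L d ℓ M}

/-- `ρ(G, d, k)`: the supremum of elasticities of sets of lengths of `G` which
are AAPs with difference `d` and length at least `k`. -/
noncomputable def rhoGdk (G : Type*) [AddCommGroup G] (d k : ℕ) : ℝ :=
  sSup (rhoL '' {L | L ∈ systemL (Set.univ : Set G) ∧ ∃ ℓ ≥ k, ∃ M : ℕ, IsAAP L d ℓ M})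

/-- `ρ(G, d)`: the limit of the decreasing sequence `(ρ(G, d, k))_k`,
i.e. its infimum. -/
noncomputable def rhoGd (G : Type*) [AddCommGroup G] (d : ℕ) : ℝ :=
  ⨅ k : ℕ, rhoGdk G d k

/-- `ρ*(G, d) = max {ρ(G₀) : G₀ ⊆ G non-half-factorial with d ∣ min Δ(G₀)}`. -/
noncomputable def rhoStar (G : Type*) [AddCommGroup G] (d : ℕ) : ℝ :=
  sSup {x | ∃ G0 : Set G, deltaG0 G0 ≠ ∅ ∧ d ∣ sInf (deltaG0 G0) ∧ x = rhoG0 G0}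

/-- The cross number `k(S) = Σ_{g ∈ S} 1/ord(g)` of a sequence `S`. -/
noncomputable def crossNum (S : Multiset G) : ℝ :=
  (S.map (fun g => (1 : ℝ) / (addOrderOf g))).sum

/-- `K(G₀) = max {k(A) : A ∈ 𝓐(G₀)}`, the cross number of `G₀`. -/
noncomputable def KG0 (G0 : Set G) : ℝ :=
  sSup {x | ∃ A : Multiset G, IsMinZeroSum G0 A ∧ x = crossNum A}

/-- `K(G, d) = max {K(G₀) : G₀ ⊆ G non-half-factorial with d ∣ min Δ(G₀)}`. -/
noncomputable def KGd (G : Type*) [AddCommGroup G] (d : ℕ) : ℝ :=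
  sSup {x | ∃ G0 : Set G, deltaG0 G0 ≠ ∅ ∧ d ∣ sInf (deltaG0 G0) ∧ x = KG0 G0}

/-- `G₀` is an LCN-set: `k(A) ≥ 1` for every atom `A` of `𝓑(G₀)`. -/
def IsLCN (G0 : Set G) : Prop :=
  ∀ A : Multiset G, IsMinZeroSum G0 A → 1 ≤ crossNum A

end Defs

section GroupRing

set_option linter.unusedSectionVars false

theorem ideal_sup_pow_eq_bot {R : Type*} [CommRing R] (I J : Ideal R) (a b : ℕ)
    (hI : I ^ (a + 1) = ⊥) (hJ : J ^ (b + 1) = ⊥) : (I ⊔ J) ^ (a + b + 1) = ⊥ := by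
  rw [← Submodule.add_eq_sup, add_pow]
  rw [Ideal.sum_eq_sup, eq_bot_iff]
  apply Finset.sup_le
  intro i hi
  have : I ^ i * J ^ (a + b + 1 - i) = ⊥ := by
    by_cases h : a + 1 ≤ i
    · obtain ⟨c, rfl⟩ := Nat.exists_eq_add_of_le h
      rw [pow_add, hI]; simp
    · have : b + 1 ≤ a + b + 1 - i := by omega
      obtain ⟨c, hc⟩ := Nat.exists_eq_add_of_le this
      rw [hc, pow_add, hJ]; simp
  rw [this]
  simp

theorem ideal_span_pow_eq_bot {R : Type*} [CommRing R] {ι : Type*} (y : ι → R) (m : ℕ)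
    (hy : ∀ i, y i ^ (m + 1) = 0) (s : Finset ι) :
    (Ideal.span (y '' s)) ^ (s.card * m + 1) = ⊥ := by
  induction s using Finset.induction_on with
  | empty => simp
  | insert a s ha ih =>
    rw [Finset.card_insert_of_notMem ha, Finset.coe_insert, Set.image_insert_eq,
      Ideal.span_insert]
    have := ideal_sup_pow_eq_bot (Ideal.span {y a}) (Ideal.span (y '' s)) m (s.card * m)
      (by rw [Ideal.span_singleton_pow, hy]; simp) ih
    rw [← this]; congr 1; ring

variable {p : ℕ} [Fact p.Prime]

noncomputable abbrev gX (p : ℕ) {H : Type*} (g : H) : AddMonoidAlgebra (ZMod p) H :=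
  AddMonoidAlgebra.single g 1

theorem gX_add {H : Type*} [AddCommGroup H] (g h : H) : gX p (g + h) = gX p g * gX p h := by
  simp [gX, AddMonoidAlgebra.single_mul_single]

theorem gX_zero {H : Type*} [AddCommGroup H] : gX p (0 : H) = 1 := rfl

theorem gX_nsmul {H : Type*} [AddCommGroup H] (m : ℕ) (g : H) :
    gX p (m • g) = gX p g ^ m := by
  induction m with
  | zero => simp [gX_zero]
  | succ m ih => rw [succ_nsmul, gX_add, ih, pow_succ]

theorem prod_sub_one_mem {H : Type*} [AddCommGroup H] (S : Multiset H) :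
    (S.map (fun g => 1 - gX p g)).prod - 1 ∈
      Submodule.span (ZMod p) {x | ∃ T ≤ S, T ≠ 0 ∧ x = gX p T.sum} := by
  induction S using Multiset.induction_on with
  | empty => simp
  | cons g S ih =>
    rw [Multiset.map_cons, Multiset.prod_cons]
    set f := (S.map (fun g => 1 - gX p g)).prod
    have e : (1 - gX p g) * f - 1 = (f - 1) - gX p g - gX p g * (f - 1) := by ring
    rw [e]
    refine Submodule.sub_mem _ (Submodule.sub_mem _ ?_ ?_) ?_
    · refine Submodule.span_mono ?_ ih
      rintro x ⟨T, hT, h0, rfl⟩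
      exact ⟨T, hT.trans (Multiset.le_cons_self _ _), h0, rfl⟩
    · apply Submodule.subset_span
      exact ⟨{g}, by simp, by simp, by simp⟩
    · have := Submodule.mem_map_of_mem (f := LinearMap.mulLeft (ZMod p) (gX p g)) ih
      rw [LinearMap.mulLeft_apply, Submodule.map_span] at this
      refine Submodule.span_mono ?_ this
      rintro x ⟨_, ⟨T, hT, h0, rfl⟩, rfl⟩
      refine ⟨g ::ₘ T, Multiset.cons_le_cons _ hT, by simp, ?_⟩
      rw [Multiset.sum_cons, gX_add]; rfl

theorem prod_ne_zero_of_zsf {H : Type*} [AddCommGroup H] (S : Multiset H)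
    (hS : ∀ T ≤ S, T ≠ 0 → T.sum ≠ 0) :
    (S.map (fun g => 1 - gX p g)).prod ≠ 0 := by
  intro h0
  have h := prod_sub_one_mem (p := p) S
  rw [h0] at h
  have : ∀ x ∈ Submodule.span (ZMod p) {x | ∃ T ≤ S, T ≠ 0 ∧ x = gX p T.sum},
      x.coeff 0 = 0 := by
    intro x hx
    induction hx using Submodule.span_induction with
    | mem x hx =>
      obtain ⟨T, hT, hn, rfl⟩ := hx
      simp [gX, hS T hT hn]
    | zero => simp
    | add x y _ _ hx hy => simp [hx, hy]
    | smul a x _ hx => simp [hx]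
  have := this _ h
  rw [← gX_zero] at this
  simp [gX] at this

theorem zsf_bound (k r : ℕ) (S : Multiset (Fin r → ZMod (p ^ k)))
    (hS : ∀ T ≤ S, T ≠ 0 → T.sum ≠ 0) :
    (S.map (fun g => p ^ k / addOrderOf g)).sum ≤ r * (p ^ k - 1) := by
  have hp : p.Prime := Fact.out
  have hn0 : 0 < p ^ k := pow_pos hp.pos k
  have : NeZero (p ^ k) := ⟨hn0.ne'⟩
  set R := AddMonoidAlgebra (ZMod p) (Fin r → ZMod (p ^ k))
  have : CharP R p := charP_of_injective_algebraMap (R := ZMod p) (A := R) (RingHom.injective (algebraMap (ZMod p) R)) p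
  set y : Fin r → R := fun i => 1 - gX p (Pi.single i 1) with hy
  set I : Ideal R := Ideal.span (y '' (Finset.univ : Finset (Fin r))) with hI
  have hfrob : ∀ (j : ℕ) (h : Fin r → ZMod (p ^ k)),
      (1 - gX p h) ^ (p ^ j) = 1 - gX p (p ^ j • h) := by
    intro j h
    rw [sub_pow_char_pow, one_pow, gX_nsmul]
  have hpow : I ^ (r * (p ^ k - 1) + 1) = ⊥ := by
    have := ideal_span_pow_eq_bot y (p ^ k - 1) (fun i => by
      rw [Nat.sub_add_cancel hn0, hy]
      simp only
      rw [hfrob]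
      have : p ^ k • (Pi.single i 1 : Fin r → ZMod (p ^ k)) = 0 := by
        ext j; simp
      rw [this, gX_zero, sub_self]) Finset.univ
    rwa [Finset.card_univ, Fintype.card_fin] at this
  have hmem : ∀ h : Fin r → ZMod (p ^ k), 1 - gX p h ∈ I := by
    let K : AddSubgroup (Fin r → ZMod (p ^ k)) :=
      { carrier := {h | 1 - gX p h ∈ I}
        zero_mem' := by simp [gX_zero]
        add_mem' := by
          intro a b ha hb
          have e : 1 - gX p (a + b) = (1 - gX p a) + gX p a * (1 - gX p b) := by
            rw [gX_add]; ring
          show 1 - gX p (a + b) ∈ I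
          rw [e]
          exact I.add_mem ha (I.mul_mem_left _ hb)
        neg_mem' := by
          intro a ha
          have e : 1 - gX p (-a) = - gX p (-a) * (1 - gX p a) := by
            have : gX p (-a) * gX p a = 1 := by rw [← gX_add]; simp [gX_zero]
            linear_combination -this
          show 1 - gX p (-a) ∈ I
          rw [e]
          exact I.mul_mem_left _ ha }
    intro h
    show h ∈ K
    rw [← Finset.univ_sum_single h]
    apply AddSubgroup.sum_mem
    intro i _
    have : (Pi.single i (h i) : Fin r → ZMod (p ^ k)) = (h i).val • Pi.single i 1 := by
      rw [← Pi.single_smul]; simp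
    rw [this]
    apply AddSubgroup.nsmul_mem
    exact Ideal.subset_span ⟨i, by simp, rfl⟩
  have hmem2 : ∀ g : Fin r → ZMod (p ^ k), 1 - gX p g ∈ I ^ (p ^ k / addOrderOf g) := by
    intro g
    have ho : addOrderOf g ∣ p ^ k := by
      apply addOrderOf_dvd_of_nsmul_eq_zero
      ext j; simp
    obtain ⟨c, hc⟩ := ho
    have ho0 : 0 < addOrderOf g := addOrderOf_pos g
    have hdiv : p ^ k / addOrderOf g = c := Nat.div_eq_of_eq_mul_right ho0 hc
    obtain ⟨j, -, hj⟩ := (Nat.dvd_prime_pow hp).1 (Dvd.intro_left _ hc.symm)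
    have hc0 : 0 < c := by rw [hj]; exact pow_pos hp.pos j
    have : ∃ h : Fin r → ZMod (p ^ k), g = c • h := by
      have : ∀ i, ∃ x : ZMod (p ^ k), g i = c • x := by
        intro i
        have h1 : addOrderOf g • (g i) = 0 := by
          have := congrFun (addOrderOf_nsmul_eq_zero g) i
          simpa using this
        have h2 : ((addOrderOf g * (g i).val : ℕ) : ZMod (p ^ k)) = 0 := by
          push_cast; rw [ZMod.natCast_zmod_val]; simpa using h1
        rw [ZMod.natCast_eq_zero_iff] at h2
        have h3 : addOrderOf g * c ∣ addOrderOf g * (g i).val := by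
          rw [← hc]; exact h2
        obtain ⟨e, he⟩ := Nat.dvd_of_mul_dvd_mul_left ho0 h3
        refine ⟨(e : ZMod (p ^ k)), ?_⟩
        rw [← ZMod.natCast_zmod_val (g i), he]; simp
      choose h hh using this
      exact ⟨h, funext hh⟩
    obtain ⟨h, hh⟩ := this
    rw [hdiv]
    nth_rewrite 1 [hh]
    rw [hj, ← hfrob]
    exact Ideal.pow_mem_pow (hmem h) _
  have hprod : ∀ T : Multiset (Fin r → ZMod (p ^ k)), (T.map (fun g => 1 - gX p g)).prod ∈
      I ^ ((T.map (fun g => p ^ k / addOrderOf g)).sum) := by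
    intro T
    induction T using Multiset.induction_on with
    | empty => simp
    | cons g T ih =>
      simp only [Multiset.map_cons, Multiset.prod_cons, Multiset.sum_cons, pow_add]
      exact Ideal.mul_mem_mul (hmem2 g) ih
  by_contra hcon
  push Not at hcon
  have h1 := Ideal.pow_le_pow_right (I := I) (Nat.succ_le_of_lt hcon) (hprod S)
  rw [Nat.succ_eq_add_one, hpow] at h1
  exact prod_ne_zero_of_zsf S hS (by simpa using h1)

end GroupRing

section Lengths

variable {G : Type*} [AddCommGroup G]

theorem lengthSet_add {G0 : Set G} {B B' : Multiset G} {k l : ℕ}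
    (hk : k ∈ lengthSet G0 B) (hl : l ∈ lengthSet G0 B') : k + l ∈ lengthSet G0 (B + B') := by
  obtain ⟨U, hU, rfl⟩ := hk
  obtain ⟨V, hV, rfl⟩ := hl
  refine ⟨Fin.append U V, ?_, ?_⟩
  · intro i
    refine Fin.addCases (fun i => ?_) (fun i => ?_) i
    · simpa using hU i
    · simpa using hV i
  · rw [Fin.sum_univ_add]; simp

theorem lengthSet_zero (G0 : Set G) : 0 ∈ lengthSet G0 (0 : Multiset G) :=
  ⟨Fin.elim0, fun i => i.elim0, by simp⟩

theorem lengthSet_atom {G0 : Set G} {A : Multiset G} (hA : IsMinZeroSum G0 A) :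
    1 ∈ lengthSet G0 A := ⟨fun _ => A, fun _ => hA, by simp⟩

theorem exists_length (G0 : Set G) (B : Multiset G) (hB : IsZeroSumSeq G0 B) :
    ∃ k, k ∈ lengthSet G0 B := by
  induction hc : Multiset.card B using Nat.strong_induction_on generalizing B with
  | _ m ih =>
    subst hc
    by_cases h0 : B = 0
    · subst h0; exact ⟨0, lengthSet_zero G0⟩
    by_cases hmin : IsMinZeroSum G0 B
    · exact ⟨1, lengthSet_atom hmin⟩
    · have : ∃ T ≤ B, T.sum = 0 ∧ T ≠ 0 ∧ T ≠ B := by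
        by_contra hcon
        push Not at hcon
        apply hmin
        refine ⟨h0, hB.1, hB.2, fun T hT hs => ?_⟩
        by_cases hT0 : T = 0
        · exact Or.inl hT0
        · exact Or.inr (hcon T hT hs hT0)
      obtain ⟨T, hT, hs, hT0, hTB⟩ := this
      obtain ⟨W, rfl⟩ := Multiset.le_iff_exists_add.1 hT
      have hW0 : W ≠ 0 := by rintro rfl; simp at hTB
      have c1 := Multiset.card_pos.2 hT0
      have c2 := Multiset.card_pos.2 hW0
      have hWs : W.sum = 0 := by
        have := hB.2; rw [Multiset.sum_add, hs, zero_add] at this; exact this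
      obtain ⟨a, ha⟩ := ih _ (by rw [Multiset.card_add]; omega) T
        ⟨fun g hg => hB.1 g (Multiset.mem_add.2 (Or.inl hg)), hs⟩ rfl
      obtain ⟨b, hb⟩ := ih _ (by rw [Multiset.card_add]; omega) W
        ⟨fun g hg => hB.1 g (Multiset.mem_add.2 (Or.inr hg)), hWs⟩ rfl
      exact ⟨a + b, lengthSet_add ha hb⟩

theorem lengthSet_pos {G0 : Set G} {B : Multiset G} (hB : B ≠ 0) {k : ℕ}
    (hk : k ∈ lengthSet G0 B) : 0 < k := by
  rcases Nat.eq_zero_or_pos k with rfl | h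
  · obtain ⟨U, _, h⟩ := hk
    simp at h; exact absurd h hB
  · exact h

theorem lengthSet_zeroSum {G0 : Set G} {B : Multiset G} {k : ℕ}
    (hk : k ∈ lengthSet G0 B) : IsZeroSumSeq G0 B := by
  obtain ⟨U, hU, rfl⟩ := hk
  constructor
  · intro g hg
    rw [Multiset.mem_sum] at hg
    obtain ⟨i, _, hi⟩ := hg
    exact (hU i).2.1 g hi
  · rw [← Multiset.coe_sumAddMonoidHom, map_sum]
    exact Finset.sum_eq_zero (fun i _ => (hU i).2.2.1)

/-- the group of length differences -/
def lenDiff (G0 : Set G) : AddSubgroup ℤ where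
  carrier := {z | ∃ (B : Multiset G) (k l : ℕ), k ∈ lengthSet G0 B ∧ l ∈ lengthSet G0 B ∧
    z = (k : ℤ) - l}
  zero_mem' := ⟨0, 0, 0, lengthSet_zero G0, lengthSet_zero G0, by simp⟩
  add_mem' := by
    rintro a b ⟨B, k, l, hk, hl, rfl⟩ ⟨B', k', l', hk', hl', rfl⟩
    exact ⟨B + B', k + k', l + l', lengthSet_add hk hk', lengthSet_add hl hl', by push_cast; ring⟩
  neg_mem' := by
    rintro a ⟨B, k, l, hk, hl, rfl⟩
    exact ⟨B, l, k, hl, hk, by ring⟩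

theorem minDelta_dvd (G0 : Set G) (d : ℕ) (hd : d ∣ sInf (deltaG0 G0)) (hne : deltaG0 G0 ≠ ∅)
    (B : Multiset G) (k l : ℕ) (hk : k ∈ lengthSet G0 B) (hl : l ∈ lengthSet G0 B) :
    (d : ℤ) ∣ (k : ℤ) - l := by
  have hmem : ((k : ℤ) - l) ∈ lenDiff G0 := ⟨B, k, l, hk, hl, rfl⟩
  obtain ⟨a, ha⟩ := Int.subgroup_cyclic (lenDiff G0)
  rw [ha, ← AddSubgroup.zmultiples_eq_closure, Int.mem_zmultiples_iff] at hmem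
  have hmin : ∀ z ∈ lenDiff G0, a ∣ z := by
    intro z hz
    rwa [ha, ← AddSubgroup.zmultiples_eq_closure, Int.mem_zmultiples_iff] at hz
  refine dvd_trans ?_ hmem
  -- elements of Δ are in lenDiff
  have hsub : ∀ x ∈ deltaG0 G0, (x : ℤ) ∈ lenDiff G0 := by
    intro x hx
    simp only [deltaG0, Set.mem_iUnion] at hx
    obtain ⟨L, ⟨B', hB', rfl⟩, h0, y, hy, hy', -⟩ := hx
    exact ⟨B', y + x, y, hy', hy, by push_cast; ring⟩
  obtain ⟨x0, hx0⟩ := Set.nonempty_iff_ne_empty.2 hne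
  have hx0pos : 0 < x0 := by
    simp only [deltaG0, Set.mem_iUnion] at hx0
    obtain ⟨L, _, h0, _⟩ := hx0
    exact h0
  have ha0 : a ≠ 0 := by
    rintro rfl
    have := hmin _ (hsub _ hx0)
    simp at this; omega
  have habs : (a.natAbs : ℤ) ∈ lenDiff G0 := by
    have haa : a ∈ lenDiff G0 := by
      rw [ha]; exact AddSubgroup.subset_closure rfl
    rcases Int.natAbs_eq a with h | h
    · rw [← h]; exact haa
    · have := (lenDiff G0).neg_mem haa
      rw [h] at this; simpa using this
  have hin : a.natAbs ∈ deltaG0 G0 := by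
    obtain ⟨B', k', l', hk', hl', e⟩ := habs
    simp only [deltaG0, Set.mem_iUnion]
    refine ⟨lengthSet G0 B', ⟨B', lengthSet_zeroSum hk', rfl⟩, by positivity, l', hl', ?_, ?_⟩
    · have : k' = l' + a.natAbs := by omega
      rwa [← this]
    · rintro c hc ⟨h1, h2⟩
      have := hmin _ (⟨B', c, l', hc, hl', rfl⟩ : ((c : ℤ) - l') ∈ lenDiff G0)
      have := Int.natAbs_dvd.2 this
      have := Int.le_of_dvd (by omega) this
      omega
  have hle : sInf (deltaG0 G0) = a.natAbs := by
    apply le_antisymm (Nat.sInf_le hin)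
    have h1 := Nat.sInf_mem ⟨x0, hx0⟩
    have h2 := Int.natAbs_dvd.2 (hmin _ (hsub _ h1))
    have hpos : 0 < sInf (deltaG0 G0) := by
      simp only [deltaG0, Set.mem_iUnion] at h1
      obtain ⟨L, _, h0, _⟩ := h1
      exact h0
    have := Int.le_of_dvd (by exact_mod_cast hpos) h2
    exact_mod_cast this
  rw [hle] at hd
  exact Int.dvd_natAbs.1 (by exact_mod_cast hd)

/-- If a set of lengths has two distinct elements, then `Δ` is nonempty. -/
theorem delta_nonempty (G0 : Set G) (B : Multiset G) (k l : ℕ) (hkl : k < l)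
    (hk : k ∈ lengthSet G0 B) (hl : l ∈ lengthSet G0 B) : deltaG0 G0 ≠ ∅ := by
  have hex : ∃ e, 0 < e ∧ k + e ∈ lengthSet G0 B := ⟨l - k, by omega, by
    rwa [show k + (l - k) = l by omega]⟩
  have h := Nat.find_spec hex
  apply Set.nonempty_iff_ne_empty.1
  refine ⟨Nat.find hex, ?_⟩
  simp only [deltaG0, Set.mem_iUnion]
  refine ⟨lengthSet G0 B, ⟨B, lengthSet_zeroSum hk, rfl⟩, h.1, k, hk, h.2, ?_⟩
  rintro c hc ⟨h1, h2⟩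
  exact Nat.find_min hex (m := c - k) (by omega) ⟨by omega, by
    rwa [show k + (c - k) = c by omega]⟩

theorem dvd_sInf_delta (G0 : Set G) (d : ℕ) (hne : deltaG0 G0 ≠ ∅)
    (h : ∀ (B : Multiset G) (k l : ℕ), k ∈ lengthSet G0 B → l ∈ lengthSet G0 B →
      (d : ℤ) ∣ (k : ℤ) - l) : d ∣ sInf (deltaG0 G0) := by
  have h1 := Nat.sInf_mem (Set.nonempty_iff_ne_empty.2 hne)
  generalize sInf (deltaG0 G0) = x at h1
  simp only [deltaG0, Set.mem_iUnion] at h1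
  obtain ⟨L, ⟨B', hB', rfl⟩, h0, y, hy, hy', -⟩ := h1
  have := h B' _ _ hy' hy
  push_cast at this
  rw [add_sub_cancel_left] at this
  exact_mod_cast this

end Lengths

section Tau

set_option linter.unusedSectionVars false

variable {G : Type*} [AddCommGroup G] [Fintype G]

noncomputable def cvec (B : Multiset G) : G → ℤ := fun g => (B.count g : ℤ)

theorem cvec_add (B B' : Multiset G) : cvec (B + B') = cvec B + cvec B' := by
  ext g; simp [cvec]

theorem cvec_inj {B B' : Multiset G} (h : cvec B = cvec B') : B = B' := by
  ext g
  have := congrFun h g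
  simpa [cvec] using this

theorem sum_cvec (B : Multiset G) : ∑ g, cvec B g • g = B.sum := by
  rw [Finset.sum_multiset_count_of_subset B Finset.univ (Finset.subset_univ _)]
  apply Finset.sum_congr rfl
  intro g _
  simp [cvec]

def Lam (G0 : Set G) : AddSubgroup (G → ℤ) where
  carrier := {c | (∀ g, g ∉ G0 → c g = 0) ∧ ∑ g, c g • g = 0}
  zero_mem' := by simp
  add_mem' := by
    rintro a b ⟨h1, h2⟩ ⟨h3, h4⟩
    refine ⟨fun g hg => by simp [h1 g hg, h3 g hg], ?_⟩
    simp [add_smul, Finset.sum_add_distrib, h2, h4]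
  neg_mem' := by
    rintro a ⟨h1, h2⟩
    refine ⟨fun g hg => by simp [h1 g hg], ?_⟩
    simp [neg_smul, h2]

theorem cvec_mem_Lam {G0 : Set G} {B : Multiset G} (hB : IsZeroSumSeq G0 B) :
    cvec B ∈ Lam G0 := by
  refine ⟨fun g hg => ?_, by rw [sum_cvec, hB.2]⟩
  simp only [cvec, Nat.cast_eq_zero, Multiset.count_eq_zero]
  exact fun h => hg (hB.1 g h)

noncomputable def kap (n : ℕ) (c : G → ℤ) : ℤ := ∑ g, c g * ((n / addOrderOf g : ℕ) : ℤ)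

noncomputable def kapM (n : ℕ) (B : Multiset G) : ℕ := (B.map (fun g => n / addOrderOf g)).sum

theorem kap_add (n : ℕ) (c c' : G → ℤ) : kap n (c + c') = kap n c + kap n c' := by
  simp [kap, add_mul, Finset.sum_add_distrib]

theorem kap_cvec (n : ℕ) (B : Multiset G) : kap n (cvec B) = (kapM n B : ℤ) := by
  rw [kapM, Finset.sum_multiset_map_count, kap]
  push_cast
  rw [← Finset.sum_subset (Finset.subset_univ B.toFinset)]
  · apply Finset.sum_congr rfl
    intro g _
    simp [cvec]
  · intro g _ hg
    simp at hg
    simp [cvec, hg]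

/-- reduction of the coefficients modulo the orders -/
noncomputable def red (c : G → ℤ) : Multiset G :=
  ∑ g, Multiset.replicate (c g % (addOrderOf g : ℤ)).toNat g

theorem cvec_red (c : G → ℤ) (g : G) : cvec (red c) g = c g % (addOrderOf g : ℤ) := by
  have h0 : (0 : ℤ) < addOrderOf g := by exact_mod_cast addOrderOf_pos g
  simp only [cvec, red, Multiset.count_sum', Multiset.count_replicate]
  rw [Finset.sum_ite_eq']
  simp [Int.toNat_of_nonneg (Int.emod_nonneg _ h0.ne')]

theorem red_zeroSum {G0 : Set G} {c : G → ℤ} (hc : c ∈ Lam G0) : IsZeroSumSeq G0 (red c) := by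
  constructor
  · intro g hg
    by_contra hg0
    have h1 := cvec_red c g
    rw [hc.1 g hg0, Int.zero_emod] at h1
    simp only [cvec, Nat.cast_eq_zero, Multiset.count_eq_zero] at h1
    exact h1 hg
  · rw [← sum_cvec, ← hc.2]
    apply Finset.sum_congr rfl
    intro g _
    rw [cvec_red, Int.emod_def, sub_smul, mul_comm, mul_smul]
    simp [addOrderOf_nsmul_eq_zero]

theorem atom_replicate {G0 : Set G} {g : G} (hg : g ∈ G0) :
    IsMinZeroSum G0 (Multiset.replicate (addOrderOf g) g) := by
  have h0 := addOrderOf_pos g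
  refine ⟨?_, ?_, ?_, ?_⟩
  · intro h
    have := congrArg Multiset.card h
    rw [Multiset.card_replicate, Multiset.card_zero] at this; omega
  · intro x hx
    rw [Multiset.eq_of_mem_replicate hx]; exact hg
  · simp [addOrderOf_nsmul_eq_zero]
  · intro T hT hs
    obtain ⟨m, hm, rfl⟩ := Multiset.le_replicate_iff.1 hT
    rw [Multiset.sum_replicate] at hs
    have := addOrderOf_dvd_of_nsmul_eq_zero hs
    rcases Nat.eq_zero_or_pos m with rfl | hpos
    · left; simp
    · right
      rw [le_antisymm hm (Nat.le_of_dvd hpos this)]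

def PP (G0 : Set G) : AddSubgroup ((G → ℤ) × ℤ) :=
  AddSubgroup.closure {x | ∃ A, IsMinZeroSum G0 A ∧ x = (cvec A, 1)}

theorem PP_form {G0 : Set G} {x : (G → ℤ) × ℤ} (hx : x ∈ PP G0) :
    ∃ B B' : Multiset G, ∃ k l : ℕ, k ∈ lengthSet G0 B ∧ l ∈ lengthSet G0 B' ∧
      x = (cvec B - cvec B', (k : ℤ) - l) := by
  induction hx using AddSubgroup.closure_induction with
  | mem x hx =>
    obtain ⟨A, hA, rfl⟩ := hx
    refine ⟨A, 0, 1, 0, lengthSet_atom hA, lengthSet_zero G0, ?_⟩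
    ext <;> simp [cvec]
  | zero =>
    refine ⟨0, 0, 0, 0, lengthSet_zero G0, lengthSet_zero G0, ?_⟩
    ext <;> simp
  | add x y _ _ hx hy =>
    obtain ⟨B, B', k, l, h1, h2, rfl⟩ := hx
    obtain ⟨C, C', k', l', h3, h4, rfl⟩ := hy
    refine ⟨B + C, B' + C', k + k', l + l', lengthSet_add h1 h3, lengthSet_add h2 h4, ?_⟩
    rw [cvec_add, cvec_add]
    ext
    · simp; ring
    · simp; ring
  | neg x _ hx =>
    obtain ⟨B, B', k, l, h1, h2, rfl⟩ := hx
    refine ⟨B', B, l, k, h2, h1, ?_⟩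
    ext <;> simp

theorem PP_zero {G0 : Set G} {d : ℕ} (hlen : ∀ (B : Multiset G) (k l : ℕ), k ∈ lengthSet G0 B →
    l ∈ lengthSet G0 B → (d : ℤ) ∣ (k : ℤ) - l) {z : ℤ} (hz : ((0 : G → ℤ), z) ∈ PP G0) :
    (d : ℤ) ∣ z := by
  obtain ⟨B, B', k, l, h1, h2, h⟩ := PP_form hz
  rw [Prod.mk.injEq] at h
  have : B = B' := cvec_inj (sub_eq_zero.1 h.1.symm)
  subst this
  rw [h.2]
  exact hlen B k l h1 h2

theorem PP_len {G0 : Set G} {B : Multiset G} {k : ℕ} (hk : k ∈ lengthSet G0 B) :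
    (cvec B, (k : ℤ)) ∈ PP G0 := by
  obtain ⟨U, hU, rfl⟩ := hk
  have : (cvec (∑ i, U i), (k : ℤ)) = ∑ i, (cvec (U i), (1 : ℤ)) := by
    ext g
    · simp [Prod.fst_sum, Finset.sum_apply, cvec, Multiset.count_sum']
    · simp [Prod.snd_sum]
  rw [this]
  exact AddSubgroup.sum_mem _ (fun i _ => AddSubgroup.subset_closure ⟨U i, hU i, rfl⟩)

theorem PP_ord {G0 : Set G} (a : G → ℤ) (ha : ∀ g, g ∉ G0 → a g = 0) :
    ((fun g => a g * (addOrderOf g : ℤ)), ∑ g, a g) ∈ PP G0 := by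
  have : ((fun g => a g * (addOrderOf g : ℤ)), ∑ g, a g) =
      ∑ g, a g • (cvec (Multiset.replicate (addOrderOf g) g), (1 : ℤ)) := by
    ext g
    · simp [Prod.fst_sum, Finset.sum_apply, cvec, Multiset.count_replicate]
    · simp [Prod.snd_sum]
  rw [this]
  refine AddSubgroup.sum_mem _ (fun g _ => ?_)
  by_cases hg : g ∈ G0
  · refine AddSubgroup.zsmul_mem (PP G0) ?_ _
    exact AddSubgroup.subset_closure ⟨_, atom_replicate hg, rfl⟩
  · rw [ha g hg, zero_smul]; exact AddSubgroup.zero_mem _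

theorem PP_full {G0 : Set G} {c : G → ℤ} (hc : c ∈ Lam G0) : ∃ z, (c, z) ∈ PP G0 := by
  obtain ⟨k, hk⟩ := exists_length G0 _ (red_zeroSum hc)
  have h1 := PP_len hk
  have h2 := PP_ord (G0 := G0) (fun g => c g / (addOrderOf g : ℤ))
    (fun g hg => by simp [hc.1 g hg])
  have := AddSubgroup.add_mem _ h1 h2
  rw [Prod.mk_add_mk] at this
  refine ⟨k + ∑ g, c g / (addOrderOf g : ℤ), ?_⟩
  convert this using 2
  ext g
  simp only [Pi.add_apply]
  rw [cvec_red]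
  rw [mul_comm]
  exact (Int.emod_add_mul_ediv _ _).symm

theorem PP_n {G0 : Set G} {n : ℕ} (hn : ∀ g : G, addOrderOf g ∣ n) {c : G → ℤ}
    (hc : ∀ g, g ∉ G0 → c g = 0) : ((n : ℤ) • c, kap n c) ∈ PP G0 := by
  have h2 := PP_ord (G0 := G0) (fun g => c g * ((n / addOrderOf g : ℕ) : ℤ))
    (fun g hg => by simp [hc g hg])
  rw [show kap n c = ∑ g, c g * ((n / addOrderOf g : ℕ) : ℤ) from rfl]
  convert h2 using 2
  ext g
  simp only [Pi.smul_apply, smul_eq_mul]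
  have : n / addOrderOf g * addOrderOf g = n := Nat.div_mul_cancel (hn g)
  rw [mul_assoc, ← Nat.cast_mul, this, mul_comm]

theorem exists_tau (G0 : Set G) (n d : ℕ) (hn : ∀ g : G, addOrderOf g ∣ n) (hd : 0 < d)
    (hn0 : 0 < n)
    (hlen : ∀ (B : Multiset G) (k l : ℕ), k ∈ lengthSet G0 B →
      l ∈ lengthSet G0 B → (d : ℤ) ∣ (k : ℤ) - l) :
    ∃ τ : Lam G0 →+ ZMod n,
      (∀ (B : Multiset G) (hB : IsZeroSumSeq G0 B) (l : ℕ), l ∈ lengthSet G0 B →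
        ∃ t : ℤ, (kapM n B : ℤ) - n * l = d * t ∧ τ ⟨cvec B, cvec_mem_Lam hB⟩ = (t : ZMod n)) ∧
      (∀ c : Lam G0, (∀ g, (addOrderOf g : ℤ) ∣ c.1 g) → τ c = 0) := by
  have hdz : (d : ℤ) ≠ 0 := by exact_mod_cast hd.ne'
  have hdiv : ∀ c ∈ Lam G0, ∀ z, (c, z) ∈ PP G0 → (d : ℤ) ∣ kap n c - n * z := by
    intro c hc z hz
    have h1 := PP_n hn hc.1
    have h2 := AddSubgroup.zsmul_mem _ hz (n : ℤ)
    have h3 := AddSubgroup.sub_mem _ h1 h2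
    apply PP_zero hlen
    convert h3 using 1
    ext <;> simp
  have huniq : ∀ (c : G → ℤ) (z z' t t' : ℤ), (c, z) ∈ PP G0 → (c, z') ∈ PP G0 →
      kap n c - n * z = d * t → kap n c - n * z' = d * t' → ((t : ZMod n) = (t' : ZMod n)) := by
    intro c z z' t t' hz hz' h h'
    have h3 := AddSubgroup.sub_mem _ hz' hz
    have h4 : (d : ℤ) ∣ z' - z := by
      apply PP_zero hlen
      convert h3 using 1
      ext <;> simp
    obtain ⟨m, hm⟩ := h4
    have : (d : ℤ) * (t - t') = d * (n * m) := by
      linear_combination h' - h + n * hm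
    have := mul_left_cancel₀ hdz this
    rw [ZMod.intCast_eq_intCast_iff_dvd_sub]
    exact ⟨-m, by linarith⟩
  have hex : ∀ c : Lam G0, ∃ t z : ℤ, (c.1, z) ∈ PP G0 ∧ kap n c.1 - n * z = d * t := by
    intro c
    obtain ⟨z, hz⟩ := PP_full c.2
    obtain ⟨t, ht⟩ := hdiv c.1 c.2 z hz
    exact ⟨t, z, hz, ht⟩
  choose t z hz ht using hex
  refine ⟨AddMonoidHom.mk' (fun c => (t c : ZMod n)) ?_, ?_, ?_⟩
  · intro a b
    rw [← Int.cast_add]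
    refine huniq (a.1 + b.1) (z (a + b)) (z a + z b) _ _ (hz (a + b)) ?_ (ht (a + b)) ?_
    · exact AddSubgroup.add_mem _ (hz a) (hz b)
    · rw [kap_add]; linear_combination ht a + ht b
  · intro B hB l hl
    obtain ⟨s, hs⟩ := hdiv _ (cvec_mem_Lam hB) l (PP_len hl)
    rw [kap_cvec] at hs
    refine ⟨s, hs, ?_⟩
    rw [← kap_cvec] at hs
    exact huniq (cvec B) _ _ _ _ (hz ⟨cvec B, cvec_mem_Lam hB⟩) (PP_len hl)
      (ht ⟨cvec B, cvec_mem_Lam hB⟩) hs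
  · intro c hc
    choose a ha using hc
    have hp := PP_ord (G0 := G0) a (fun g hg => by
      have h1 := ha g
      rw [c.2.1 g hg] at h1
      have h0 : (addOrderOf g : ℤ) ≠ 0 := by exact_mod_cast (addOrderOf_pos g).ne'
      rcases mul_eq_zero.1 h1.symm with h | h
      · exact absurd h h0
      · exact h)
    have e : (fun g => a g * (addOrderOf g : ℤ)) = c.1 := by
      ext g; rw [ha g]; ring
    rw [e] at hp
    have : ((t c : ℤ) : ZMod n) = ((0 : ℤ) : ZMod n) := by
      refine huniq c.1 _ _ _ _ (hz c) hp (ht c) ?_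
      rw [mul_zero, sub_eq_zero, kap, Finset.mul_sum]
      apply Finset.sum_congr rfl
      intro g _
      rw [ha g]
      have : ((n / addOrderOf g : ℕ) : ℤ) * addOrderOf g = n := by
        exact_mod_cast Nat.div_mul_cancel (hn g)
      linear_combination a g * this
    simpa using this

end Tau

section Upper

set_option linter.unusedSectionVars false

variable {G : Type*} [AddCommGroup G] [Fintype G]

theorem kapM_add (n : ℕ) (B B' : Multiset G) : kapM n (B + B') = kapM n B + kapM n B' := by
  simp [kapM]

theorem kapM_nsmul (n j : ℕ) (B : Multiset G) : kapM n (j • B) = j * kapM n B := by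
  simp [kapM, Multiset.map_nsmul, Multiset.sum_nsmul]

theorem kapM_sum (n : ℕ) {ι : Type*} (s : Finset ι) (U : ι → Multiset G) :
    kapM n (∑ i ∈ s, U i) = ∑ i ∈ s, kapM n (U i) := by
  induction s using Finset.induction_on with
  | empty => simp [kapM]
  | insert a s ha ih => rw [Finset.sum_insert ha, Finset.sum_insert ha, kapM_add, ih]

theorem kapM_replicate (n : ℕ) (hn : ∀ g : G, addOrderOf g ∣ n) (g : G) :
    kapM n (Multiset.replicate (addOrderOf g) g) = n := by
  simp [kapM, Multiset.map_replicate, Multiset.sum_replicate]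
  exact Nat.mul_div_cancel' (hn g)

theorem lengthSet_mul_le {G0 : Set G} {n m : ℕ}
    (h : ∀ A, IsMinZeroSum G0 A → m ≤ kapM n A) {B : Multiset G} {l : ℕ}
    (hl : l ∈ lengthSet G0 B) : l * m ≤ kapM n B := by
  obtain ⟨U, hU, rfl⟩ := hl
  rw [kapM_sum]
  calc l * m = ∑ _i : Fin l, m := by simp
    _ ≤ _ := Finset.sum_le_sum (fun i _ => h _ (hU i))

theorem atom_zero {G0 : Set G} {A : Multiset G} (hA : IsMinZeroSum G0 A) (h0 : (0 : G) ∈ A) :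
    A = {0} := by
  rcases hA.2.2.2 {0} (by simpa using h0) (by simp) with h | h
  · simp at h
  · exact h.symm

theorem atom_bound {p k r n : ℕ} [Fact p.Prime] (hpk : n = p ^ k) (hr : n / 2 + 1 ≤ r)
    (hr2 : 2 ≤ r) (f : G →+ (Fin r → ZMod n)) (hf : Function.Injective f)
    {G0 : Set G} {A : Multiset G} (hA : IsMinZeroSum G0 A) : kapM n A < n * r := by
  subst hpk
  have hp : p.Prime := Fact.out
  have hn0 : 0 < p ^ k := pow_pos hp.pos k
  by_cases h0 : (0 : G) ∈ A
  · rw [atom_zero hA h0]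
    simp [kapM]
    nlinarith
  obtain ⟨g, hg⟩ := Multiset.exists_mem_of_ne_zero hA.1
  obtain ⟨S, rfl⟩ := Multiset.exists_cons_of_mem hg
  have hzs : ∀ T ≤ S.map f, T ≠ 0 → T.sum ≠ 0 := by
    intro T hT hT0 hs
    have hT' : T.map (Function.invFun f) ≤ S := by
      have := Multiset.map_le_map (f := Function.invFun f) hT
      rwa [Multiset.map_map, Function.invFun_comp hf, Multiset.map_id] at this
    have hT2 : (T.map (Function.invFun f)).map f = T := by
      rw [Multiset.map_map]
      conv_rhs => rw [← Multiset.map_id T]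
      apply Multiset.map_congr rfl
      intro x hx
      have := Multiset.mem_of_le hT hx
      rw [Multiset.mem_map] at this
      obtain ⟨y, _, rfl⟩ := this
      simp [Function.leftInverse_invFun hf y]
    have hs0 : (T.map (Function.invFun f)).sum = 0 := by
      apply hf
      rw [map_multiset_sum, hT2, hs, map_zero]
    rcases hA.2.2.2 _ (hT'.trans (Multiset.le_cons_self _ _)) hs0 with h | h
    · exact hT0 (Multiset.map_eq_zero.1 h)
    · have := Multiset.card_le_card hT'
      rw [h] at this
      simp at this
  have hb := zsf_bound k r (S.map f) hzs
  have e : ((S.map f).map (fun g => p ^ k / addOrderOf g)).sum = kapM (p ^ k) S := by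
    rw [Multiset.map_map, kapM]
    congr 1
    apply Multiset.map_congr rfl
    intro x _
    simp [addOrderOf_injective f hf x]
  rw [e] at hb
  have hg0 : g ≠ 0 := by rintro rfl; exact h0 hg
  have ho : 2 ≤ addOrderOf g := by
    have h1 := addOrderOf_pos g
    have h2 : addOrderOf g ≠ 1 := by simpa using hg0
    omega
  have hle : p ^ k / addOrderOf g ≤ p ^ k / 2 := Nat.div_le_div_left ho (by norm_num)
  have e2 : kapM (p ^ k) (g ::ₘ S) = p ^ k / addOrderOf g + kapM (p ^ k) S := by simp [kapM]
  rw [e2]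
  have : r * (p ^ k - 1) + r = p ^ k * r := by
    obtain ⟨m, hm⟩ := Nat.exists_eq_add_of_lt hn0
    rw [hm]; simp; ring
  omega

theorem kapM_two_le {n : ℕ} (hn2 : 2 ≤ n) (hn : ∀ g : G, addOrderOf g ∣ n)
    {G0 : Set G} {A : Multiset G} (hA : IsMinZeroSum G0 A) : 2 ≤ kapM n A := by
  have hpos : ∀ g : G, 1 ≤ n / addOrderOf g := fun g =>
    Nat.div_pos (Nat.le_of_dvd (by omega) (hn g)) (addOrderOf_pos g)
  obtain ⟨g, hg⟩ := Multiset.exists_mem_of_ne_zero hA.1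
  obtain ⟨S, rfl⟩ := Multiset.exists_cons_of_mem hg
  by_cases hS : S = 0
  · subst hS
    have : g = 0 := by simpa using hA.2.2.1
    subst this
    simpa [kapM] using hn2
  · obtain ⟨h, hh⟩ := Multiset.exists_mem_of_ne_zero hS
    obtain ⟨S', rfl⟩ := Multiset.exists_cons_of_mem hh
    simp [kapM]
    have := hpos g
    have := hpos h
    omega

theorem small_atom {G0 : Set G} {n d : ℕ} (hn2 : 2 ≤ n) (hn : ∀ g : G, addOrderOf g ∣ n)
    (hd : 0 < d) (hnd : n / 2 ≤ d) (τ : Lam G0 →+ ZMod n)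
    (hτ : ∀ (B : Multiset G) (hB : IsZeroSumSeq G0 B) (l : ℕ), l ∈ lengthSet G0 B →
        ∃ t : ℤ, (kapM n B : ℤ) - n * l = d * t ∧ τ ⟨cvec B, cvec_mem_Lam hB⟩ = (t : ZMod n))
    (hτ0 : ∀ c : Lam G0, (∀ g, (addOrderOf g : ℤ) ∣ c.1 g) → τ c = 0)
    {U : Multiset G} (hU : IsMinZeroSum G0 U) (hk : kapM n U < n) : U.Nodup := by
  have hgen : ∀ V, IsMinZeroSum G0 V → n ≤ kapM n V + d := by
    intro V hV
    obtain ⟨t, ht, -⟩ := hτ V ⟨hV.2.1, hV.2.2.1⟩ 1 (lengthSet_atom hV)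
    have h2 := kapM_two_le hn2 hn hV
    have : -2 < t := by
      by_contra hcon
      have : (d : ℤ) * t ≤ d * (-2) := mul_le_mul_of_nonneg_left (by omega) (by omega)
      push_cast at ht
      omega
    have : (d : ℤ) * (-1) ≤ d * t := mul_le_mul_of_nonneg_left (by omega) (by omega)
    push_cast at ht
    omega
  obtain ⟨t, ht, hτU⟩ := hτ U ⟨hU.2.1, hU.2.2.1⟩ 1 (lengthSet_atom hU)
  have h2 := kapM_two_le hn2 hn hU
  have hU1 := hgen U hU
  have ht1 : t = -1 := by
    have a1 : t < 0 := by
      by_contra hcon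
      have : (0 : ℤ) ≤ d * t := mul_nonneg (by omega) (by omega)
      push_cast at ht
      omega
    have a2 : -2 < t := by
      by_contra hcon
      have : (d : ℤ) * t ≤ d * (-2) := mul_le_mul_of_nonneg_left (by omega) (by omega)
      push_cast at ht
      omega
    omega
  subst ht1
  have hkU : (kapM n U : ℤ) = n - d := by push_cast at ht; linarith
  by_contra hnd'
  rw [Multiset.nodup_iff_count_le_one] at hnd'
  push Not at hnd'
  obtain ⟨g, hg⟩ := hnd'
  obtain ⟨j, hj⟩ : ∃ j, j = (n + 1) / 2 := ⟨_, rfl⟩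
  have hjd : j ≤ d + 1 := by omega
  have hjn : n ≤ 2 * j := by omega
  have hog : addOrderOf g ≤ n := Nat.le_of_dvd (by omega) (hn g)
  have hgU : g ∈ U := Multiset.count_pos.1 (by omega)
  have hgG : g ∈ G0 := hU.2.1 g hgU
  have hE : Multiset.replicate (addOrderOf g) g ≤ j • U := by
    rw [← Multiset.le_count_iff_replicate_le, Multiset.count_nsmul]
    nlinarith
  obtain ⟨V, hV⟩ := Multiset.le_iff_exists_add.1 hE
  have hEz : IsZeroSumSeq G0 (Multiset.replicate (addOrderOf g) g) :=
    ⟨(atom_replicate hgG).2.1, (atom_replicate hgG).2.2.1⟩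
  have hVz : IsZeroSumSeq G0 V := by
    constructor
    · intro x hx
      have : x ∈ j • U := by rw [hV]; exact Multiset.mem_add.2 (Or.inr hx)
      exact hU.2.1 x (Multiset.mem_of_mem_nsmul this)
    · have := congrArg Multiset.sum hV
      rw [Multiset.sum_nsmul, hU.2.2.1, Multiset.sum_add, hEz.2] at this
      simpa using this.symm
  obtain ⟨l, hl⟩ := exists_length G0 V hVz
  obtain ⟨s, hs, hτV⟩ := hτ V hVz l hl
  have hcv : j • (⟨cvec U, cvec_mem_Lam ⟨hU.2.1, hU.2.2.1⟩⟩ : Lam G0) =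
      ⟨_, cvec_mem_Lam hEz⟩ + ⟨_, cvec_mem_Lam hVz⟩ := by
    apply Subtype.ext
    show j • cvec U = cvec _ + cvec V
    rw [← cvec_add, ← hV]
    ext x
    simp [cvec]
  have hτE : τ ⟨_, cvec_mem_Lam hEz⟩ = 0 := by
    apply hτ0
    intro x
    simp only [cvec, Multiset.count_replicate]
    split_ifs with h
    · rw [h]
    · simp
  have h3 := congrArg τ hcv
  rw [map_nsmul, map_add, hτE, hτU, hτV, zero_add] at h3
  have h4 : (n : ℤ) ∣ s + j := by
    rw [← ZMod.intCast_zmod_eq_zero_iff_dvd] 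
    push_cast
    rw [← h3]
    simp
  have hkV : n + kapM n V = j * kapM n U := by
    have := congrArg (kapM n) hV
    rw [kapM_add, kapM_nsmul, kapM_replicate n hn] at this
    exact this.symm
  have hkVz : (n : ℤ) + kapM n V = j * (n - d) := by
    rw [← hkU]; exact_mod_cast hkV
  have hl1 : l * (n - d) ≤ kapM n V :=
    lengthSet_mul_le (fun V hV => by have := hgen V hV; omega) hl
  have hdn : d < n := by omega
  have hl1z : (l : ℤ) * (n - d) ≤ kapM n V := by
    have : ((n - d : ℕ) : ℤ) = n - d := by omega
    rw [← this]; exact_mod_cast hl1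
  have hlj : (l : ℤ) < j := by
    by_contra hcon
    push Not at hcon
    have : (j : ℤ) * (n - d) ≤ l * (n - d) := mul_le_mul_of_nonneg_right hcon (by omega)
    omega
  have hdz : (0 : ℤ) < d := by exact_mod_cast hd
  have hsl : -(l : ℤ) ≤ s := by
    have : (d : ℤ) * (-l) ≤ d * s := by rw [← hs]; linarith
    exact le_of_mul_le_mul_left this hdz
  have h5 : (n : ℤ) ≤ s + j := Int.le_of_dvd (by omega) h4
  have h6 : (d : ℤ) * (n - j) ≤ d * s := mul_le_mul_of_nonneg_left (by omega) hdz.le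
  have h7 : (n : ℤ) * (1 + l + d) ≤ n * j := by nlinarith
  have h8 : (1 + l + d : ℤ) ≤ j := le_of_mul_le_mul_left h7 (by omega)
  have hl0 : l = 0 := by omega
  subst hl0
  have hV0 : V = 0 := by
    obtain ⟨W, _, hW⟩ := hl
    simpa using hW
  subst hV0
  have hs0 : s = 0 := by
    simp [kapM] at hs
    rcases hs with h | h
    · omega
    · exact h
  subst hs0
  have : d + 2 ≤ n := by omega
  omega

theorem lcn_bound {G0 : Set G} {n d : ℕ} (hn0 : 0 < n) (hn : ∀ g : G, addOrderOf g ∣ n)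
    (hd : 0 < d) (τ : Lam G0 →+ ZMod n)
    (hτ : ∀ (B : Multiset G) (hB : IsZeroSumSeq G0 B) (l : ℕ), l ∈ lengthSet G0 B →
        ∃ t : ℤ, (kapM n B : ℤ) - n * l = d * t ∧ τ ⟨cvec B, cvec_mem_Lam hB⟩ = (t : ZMod n))
    (hτ0 : ∀ c : Lam G0, (∀ g, (addOrderOf g : ℤ) ∣ c.1 g) → τ c = 0)
    (hlcn : ∀ A, IsMinZeroSum G0 A → n ≤ kapM n A)
    (w : Lam G0) (hw : (Finset.univ.filter (fun g => w.1 g ≠ 0)).card ≤ d + 1) : τ w = 0 := by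
  by_contra hne
  have hred : ∀ c : Lam G0, τ ⟨cvec (red c.1), cvec_mem_Lam (red_zeroSum c.2)⟩ = τ c := by
    intro c
    have := hτ0 (⟨cvec (red c.1), cvec_mem_Lam (red_zeroSum c.2)⟩ - c) (by
      intro g
      show _ ∣ cvec (red c.1) g - c.1 g
      rw [cvec_red, ← dvd_neg, neg_sub]
      exact Int.dvd_self_sub_emod)
    rw [map_sub, sub_eq_zero] at this
    exact this
  have key : ∀ c : Lam G0, τ c ≠ 0 → ∃ t : ℤ, ∃ l : ℕ, 1 ≤ l ∧ 0 ≤ t ∧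
      (kapM n (red c.1) : ℤ) = n * l + d * t ∧ τ c = (t : ZMod n) := by
    intro c hc
    obtain ⟨l, hl⟩ := exists_length G0 _ (red_zeroSum c.2)
    obtain ⟨t, ht, hτt⟩ := hτ _ (red_zeroSum c.2) l hl
    have hle := lengthSet_mul_le hlcn hl
    rw [hred] at hτt
    refine ⟨t, l, ?_, ?_, by linarith, hτt⟩
    · rcases Nat.eq_zero_or_pos l with rfl | h
      · exfalso
        obtain ⟨W, _, hW⟩ := hl
        have hW0 : red c.1 = 0 := by simpa using hW
        rw [hW0] at ht
        simp [kapM] at ht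
        rcases ht with h | h
        · omega
        · rw [h] at hτt; simp at hτt; exact hc hτt
      · exact h
    · have h1 : (0 : ℤ) ≤ d * t := by
        rw [← ht]
        have : (l : ℤ) * n ≤ kapM n (red c.1) := by exact_mod_cast hle
        linarith
      exact nonneg_of_mul_nonneg_right h1 (by exact_mod_cast hd)
  obtain ⟨t, l, hl, ht0, h1, h2⟩ := key w hne
  obtain ⟨t', l', hl', ht0', h1', h2'⟩ := key (-w) (by rwa [map_neg, neg_ne_zero])
  have htt : (n : ℤ) ∣ t + t' := by
    rw [← ZMod.intCast_zmod_eq_zero_iff_dvd]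
    push_cast
    rw [← h2, ← h2', map_neg, add_neg_cancel]
  have htpos : 0 < t + t' := by
    rcases lt_or_eq_of_le ht0 with h | h
    · omega
    · exfalso; apply hne; rw [h2, ← h]; simp
  have h3 : (n : ℤ) ≤ t + t' := Int.le_of_dvd htpos htt
  have hsum : (kapM n (red w.1) : ℤ) + kapM n (red (-w).1) ≤ n * (d + 1) := by
    rw [← kap_cvec, ← kap_cvec, kap, kap, ← Finset.sum_add_distrib]
    calc _ ≤ ∑ g, (if w.1 g ≠ 0 then (n : ℤ) else 0) := by
          apply Finset.sum_le_sum
          intro g _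
          rw [cvec_red, cvec_red]
          show w.1 g % _ * _ + (-(w.1 g)) % _ * _ ≤ _
          have ho : (0 : ℤ) < addOrderOf g := by exact_mod_cast addOrderOf_pos g
          split_ifs with h
          · rw [← add_mul]
            have h4 : ((n / addOrderOf g : ℕ) : ℤ) * addOrderOf g = n := by
              exact_mod_cast Nat.div_mul_cancel (hn g)
            have h5 : w.1 g % (addOrderOf g : ℤ) + (-(w.1 g)) % (addOrderOf g : ℤ) ≤
                addOrderOf g := by
              have a1 := Int.emod_lt_of_pos (w.1 g) ho
              have a2 := Int.emod_lt_of_pos (-(w.1 g)) ho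
              have a3 : (addOrderOf g : ℤ) ∣
                  w.1 g % (addOrderOf g : ℤ) + (-(w.1 g)) % (addOrderOf g : ℤ) := by
                apply Int.dvd_of_emod_eq_zero
                rw [← Int.add_emod]; simp
              obtain ⟨m, hm⟩ := a3
              have : m < 2 := by
                by_contra hcon
                have : (addOrderOf g : ℤ) * 2 ≤ addOrderOf g * m :=
                  mul_le_mul_of_nonneg_left (by omega) ho.le
                omega
              rw [hm]
              nlinarith
            rw [← h4, mul_comm]
            exact mul_le_mul_of_nonneg_left h5 (by positivity)
          · push Not at h
            simp [h]
      _ = n * ((Finset.univ.filter (fun g => w.1 g ≠ 0)).card : ℤ) := by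
          rw [← Finset.sum_filter, Finset.sum_const, nsmul_eq_mul, mul_comm]
      _ ≤ _ := mul_le_mul_of_nonneg_left (by exact_mod_cast hw) (by positivity)
  rw [h1, h1'] at hsum
  have h6 : (d : ℤ) * n ≤ d * (t + t') := mul_le_mul_of_nonneg_left h3 (by positivity)
  have h7 : (n : ℤ) * 2 ≤ n * (l + l') := mul_le_mul_of_nonneg_left (by omega) (by positivity)
  have : (0 : ℤ) < n := by exact_mod_cast hn0
  nlinarith

end Upper

section Dep

set_option linter.unusedSectionVars false

variable {G : Type*} [AddCommGroup G] [Fintype G]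

theorem card_ptors_le {p r n : ℕ} (hp : 0 < p) [NeZero n] (i0 : Fin r) :
    (Finset.univ.filter (fun y : Fin r → ZMod n => y i0 = 0 ∧ p • y = 0)).card ≤ p ^ (r - 1) := by
  have hsub : (Finset.univ.filter (fun y : Fin r → ZMod n => y i0 = 0 ∧ p • y = 0)) ⊆
      Fintype.piFinset (fun i : Fin r => if i = i0 then ({0} : Finset (ZMod n)) else
        Finset.univ.filter (fun x : ZMod n => p • x = 0)) := by
    intro y hy
    rw [Finset.mem_filter] at hy
    rw [Fintype.mem_piFinset]
    intro i
    split_ifs with h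
    · rw [h]; simp [hy.2.1]
    · simp only [Finset.mem_filter, Finset.mem_univ, true_and]
      exact congrFun hy.2.2 i
  refine (Finset.card_le_card hsub).trans ?_
  rw [Fintype.card_piFinset, ← Finset.mul_prod_erase _ _ (Finset.mem_univ i0)]
  simp only [if_true, Finset.card_singleton, one_mul]
  calc _ ≤ ∏ _i ∈ (Finset.univ : Finset (Fin r)).erase i0, p := by
        apply Finset.prod_le_prod'
        intro i hi
        rw [if_neg (Finset.ne_of_mem_erase hi)]
        exact IsAddCyclic.card_nsmul_eq_zero_le hp
    _ = _ := by simp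

theorem exists_dep {p k r n n1 : ℕ} [Fact p.Prime] (hpk : n = p ^ k)
    (f : G →+ (Fin r → ZMod n)) (hf : Function.Injective f) (i0 : Fin r)
    (hf0 : ∀ g, f (n1 • g) i0 = 0) (D : Finset G) (hD : D.card = r) :
    ∃ v : G → ℤ, ∃ g ∈ D, (∀ h, h ∉ D → v h = 0) ∧ v g = 1 ∧ ∑ h, v h • (n1 • h) = 0 := by
  have hp : p.Prime := Fact.out
  have hn0 : 0 < n := by rw [hpk]; exact pow_pos hp.pos k
  have : NeZero n := ⟨hn0.ne'⟩
  let F : (D → ℤ) →+ G :=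
    { toFun := fun y => ∑ h : D, y h • (n1 • (h : G))
      map_zero' := by simp
      map_add' := by intro a b; simp [add_smul, Finset.sum_add_distrib] }
  have hF : ∀ y, F y = ∑ h : D, y h • (n1 • (h : G)) := fun y => rfl
  let M := F.range
  let μ : M →+ M := nsmulAddMonoidHom p
  have hker : Nat.card μ.ker ≤ p ^ (r - 1) := by
    have hinj : ∃ φ : μ.ker → {y // y ∈ (Finset.univ.filter
        (fun y : Fin r → ZMod n => y i0 = 0 ∧ p • y = 0))}, Function.Injective φ := by
      refine ⟨fun x => ⟨f (x.1 : G), ?_⟩, ?_⟩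
      · obtain ⟨⟨x, y, hy⟩, hx⟩ := x
        simp only [Finset.mem_filter, Finset.mem_univ, true_and]
        constructor
        · have : F y = n1 • ∑ h : D, y h • (h : G) := by
            rw [hF, Finset.smul_sum]
            exact Finset.sum_congr rfl (fun h _ => smul_comm _ _ _)
          rw [← hy, this]
          exact hf0 _
        · have hx' : p • x = 0 := congrArg Subtype.val hx
          rw [← map_nsmul, hx', map_zero]
      · intro a b hab
        have : f (a.1 : G) = f (b.1 : G) := congrArg Subtype.val hab
        exact Subtype.ext (Subtype.ext (hf this))
    obtain ⟨φ, hφ⟩ := hinj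
    have := Nat.card_le_card_of_injective φ hφ
    refine this.trans ?_
    rw [Nat.card_eq_fintype_card, Fintype.card_coe]
    exact card_ptors_le hp.pos i0
  have hidx : Nat.card (M ⧸ μ.range) ≤ p ^ (r - 1) := by
    have : μ.range.index = Nat.card μ.ker := AddSubgroup.index_range
    rw [← AddSubgroup.index_eq_card, this]; exact hker
  have hpig : ∃ a b : D → Fin p, a ≠ b ∧
      (QuotientAddGroup.mk (⟨F (fun h => ((a h : ℕ) : ℤ)), ⟨_, rfl⟩⟩ : M) : M ⧸ μ.range) =
      QuotientAddGroup.mk (⟨F (fun h => ((b h : ℕ) : ℤ)), ⟨_, rfl⟩⟩ : M) := by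
    by_contra hcon
    push Not at hcon
    have hinj : Function.Injective (fun a : D → Fin p =>
      (QuotientAddGroup.mk (⟨F (fun h => ((a h : ℕ) : ℤ)), ⟨_, rfl⟩⟩ : M) : M ⧸ μ.range)) := by
      intro a b hab
      by_contra hne
      exact hcon a b hne hab
    have h1 := Nat.card_le_card_of_injective _ hinj
    rw [Nat.card_eq_fintype_card, Fintype.card_fun, Fintype.card_coe, Fintype.card_fin, hD] at h1
    have h2 := h1.trans hidx
    have h3 := (Nat.pow_le_pow_iff_right hp.one_lt).1 h2
    have := i0.pos
    omega
  obtain ⟨a, b, hab, hq⟩ := hpig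
  rw [QuotientAddGroup.eq] at hq
  obtain ⟨⟨m, y, hy⟩, hm⟩ := hq
  have hm' : p • m = - F (fun h => ((a h : ℕ) : ℤ)) + F (fun h => ((b h : ℕ) : ℤ)) :=
    congrArg Subtype.val hm
  obtain ⟨g, hg⟩ := Function.ne_iff.1 hab
  let v' : D → ℤ := fun h => ((b h : ℕ) : ℤ) - ((a h : ℕ) : ℤ) - p * y h
  have hv' : F v' = 0 := by
    have : v' = (fun h => ((b h : ℕ) : ℤ)) - (fun h => ((a h : ℕ) : ℤ)) - p • y := by
      ext h; simp [v']
    rw [this, map_sub, map_sub, map_nsmul, hy, hm']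
    abel
  have hcop : IsCoprime (v' g) (n : ℤ) := by
    rw [hpk]; push_cast
    apply IsCoprime.pow_right
    apply IsCoprime.symm
    rw [(Nat.prime_iff_prime_int.1 hp).irreducible.coprime_iff_not_dvd]
    intro hdv
    have h1 : (p : ℤ) ∣ ((b g : ℕ) : ℤ) - ((a g : ℕ) : ℤ) := by
      have := dvd_add hdv (Dvd.intro (y g) rfl : (p : ℤ) ∣ p * y g)
      simpa [v'] using this
    have ha := (a g).isLt
    have hb := (b g).isLt
    have h2 := Int.eq_zero_of_abs_lt_dvd h1 (by rw [abs_lt]; constructor <;> omega)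
    exact hg (Fin.ext (by omega))
  obtain ⟨u, m', hum⟩ := hcop
  refine ⟨fun h => if hh : h ∈ D then u * v' ⟨h, hh⟩ + (if h = g then m' * n else 0) else 0,
    g, g.2, fun h hh => by simp [hh], ?_, ?_⟩
  · simp; linarith
  · have hng : ∀ x : G, (n : ℤ) • x = 0 := by
      intro x
      apply hf
      rw [map_zsmul, map_zero]
      ext i; simp
    rw [← Finset.sum_subset (Finset.subset_univ D) (fun x _ hx => by simp [hx]),
      ← Finset.sum_coe_sort]
    have : ∀ h : D, (if hh : (h : G) ∈ D then u * v' ⟨h, hh⟩ + (if (h : G) = g then m' * n else 0)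
        else 0) • (n1 • (h : G)) = u • (v' h • (n1 • (h : G))) := by
      intro h
      rw [dif_pos h.2, add_smul, mul_smul]
      split_ifs
      · rw [mul_smul, hng]; simp
      · simp
    rw [Finset.sum_congr rfl (fun h _ => this h), ← Finset.smul_sum, ← hF, hv', smul_zero]

theorem tau_zero {G0 : Set G} {p k d n n1 : ℕ} [Fact p.Prime] (hpk : n = p ^ k)
    (hn : ∀ g : G, addOrderOf g ∣ n) (hd : 0 < d)
    (f : G →+ (Fin (d + 1) → ZMod n)) (hf : Function.Injective f) (i0 : Fin (d + 1))
    (hf0 : ∀ g, f (n1 • g) i0 = 0) (τ : Lam G0 →+ ZMod n)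
    (hτ : ∀ (B : Multiset G) (hB : IsZeroSumSeq G0 B) (l : ℕ), l ∈ lengthSet G0 B →
        ∃ t : ℤ, (kapM n B : ℤ) - n * l = d * t ∧ τ ⟨cvec B, cvec_mem_Lam hB⟩ = (t : ZMod n))
    (hτ0 : ∀ c : Lam G0, (∀ g, (addOrderOf g : ℤ) ∣ c.1 g) → τ c = 0)
    (hlcn : ∀ A, IsMinZeroSum G0 A → n ≤ kapM n A)
    (N : ℕ) (c : G → ℤ) (hN : (Finset.univ.filter (fun g => c g ≠ 0)).card ≤ N)
    (hc : n1 • c ∈ Lam G0) (hc0 : ∀ g, g ∉ G0 → c g = 0) : τ ⟨n1 • c, hc⟩ = 0 := by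
  have hn0 : 0 < n := by rw [hpk]; exact pow_pos (Fact.out : p.Prime).pos k
  have hbase : ∀ (c : G → ℤ) (hc : n1 • c ∈ Lam G0),
      (Finset.univ.filter (fun g => c g ≠ 0)).card ≤ d + 1 → τ ⟨n1 • c, hc⟩ = 0 := by
    intro c hc h
    refine lcn_bound hn0 hn hd τ hτ hτ0 hlcn _ (le_trans (Finset.card_le_card ?_) h)
    intro g
    simp only [Finset.mem_filter, Finset.mem_univ, true_and]
    intro h1 h2
    apply h1
    simp [h2]
  induction N generalizing c with
  | zero => exact hbase c hc (by omega)
  | succ N ih =>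
    by_cases hle : (Finset.univ.filter (fun g => c g ≠ 0)).card ≤ d + 1
    · exact hbase c hc hle
    push Not at hle
    obtain ⟨D, hDs, hD⟩ := Finset.exists_subset_card_eq hle.le
    obtain ⟨v, g, hgD, hv0, hv1, hvs⟩ := exists_dep hpk f hf i0 hf0 D hD
    have hDG : ∀ x, x ∉ G0 → x ∉ D := by
      intro x hx hxD
      have := hDs hxD
      simp only [Finset.mem_filter, Finset.mem_univ, true_and] at this
      exact this (hc0 x hx)
    have hvL : n1 • v ∈ Lam G0 := by
      refine ⟨fun x hx => by simp [hv0 x (hDG x hx)], ?_⟩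
      rw [← hvs]
      apply Finset.sum_congr rfl
      intro x _
      simp only [Pi.smul_apply]
      rw [smul_assoc, smul_comm]
    have hτv : τ ⟨n1 • v, hvL⟩ = 0 := by
      apply hbase
      rw [← hD]
      apply Finset.card_le_card
      intro x
      simp only [Finset.mem_filter, Finset.mem_univ, true_and]
      intro hx
      by_contra hxD
      exact hx (hv0 x hxD)
    have hc'L : n1 • (c - c g • v) ∈ Lam G0 := by
      have : n1 • (c - c g • v) = n1 • c - c g • (n1 • v) := by
        rw [smul_sub, smul_comm]
      rw [this]
      exact AddSubgroup.sub_mem _ hc (AddSubgroup.zsmul_mem _ hvL _)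
    have h1 : τ ⟨n1 • (c - c g • v), hc'L⟩ = 0 := by
      apply ih
      · have hlt : (Finset.univ.filter (fun x => (c - c g • v) x ≠ 0)).card <
            (Finset.univ.filter (fun x => c x ≠ 0)).card := by
          apply Finset.card_lt_card
          rw [Finset.ssubset_iff_of_subset]
          · refine ⟨g, hDs hgD, ?_⟩
            simp [hv1]
          · intro x
            simp only [Finset.mem_filter, Finset.mem_univ, true_and]
            intro hx hcx
            apply hx
            have hxD : x ∉ D := fun hxD => by
              have := hDs hxD
              simp only [Finset.mem_filter, Finset.mem_univ, true_and] at this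
              exact this hcx
            simp [hcx, hv0 x hxD]
        omega
      · intro x hx
        simp [hc0 x hx, hv0 x (hDG x hx)]
    have e : (⟨n1 • c, hc⟩ : Lam G0) = ⟨n1 • (c - c g • v), hc'L⟩ + c g • ⟨n1 • v, hvL⟩ := by
      apply Subtype.ext
      show n1 • c = n1 • (c - c g • v) + c g • (n1 • v)
      rw [smul_sub, smul_comm (c g) n1 v]
      abel
    rw [e, map_add, map_zsmul, h1, hτv]
    simp

/-- Upper bound, in integral form. -/
theorem upper_int {G0 : Set G} {p k d n n1 : ℕ} [Fact p.Prime] (hpk : n = p ^ k) (hn2 : 2 ≤ n)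
    (hd : 0 < d) (hnd : n / 2 ≤ d) (hn1 : 0 < n1) (hn1n : n1 ∣ n)
    (f : G →+ (Fin (d + 1) → ZMod n)) (hf : Function.Injective f) (i0 : Fin (d + 1))
    (hf0 : ∀ g, f (n1 • g) i0 = 0)
    (hlen : ∀ (B : Multiset G) (k l : ℕ), k ∈ lengthSet G0 B →
      l ∈ lengthSet G0 B → (d : ℤ) ∣ (k : ℤ) - l)
    {A : Multiset G} (hA : IsMinZeroSum G0 A) :
    n1 * kapM n A ≤ n * (n1 + (n1 - 1) * d) := by
  have hn : ∀ g : G, addOrderOf g ∣ n := by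
    intro g
    apply addOrderOf_dvd_of_nsmul_eq_zero
    apply hf
    rw [map_nsmul, map_zero]
    ext i; simp
  by_cases hsm : kapM n A ≤ n
  · nlinarith [Nat.zero_le (n * ((n1 - 1) * d))]
  push Not at hsm
  set G1 : Set G := {g | g ∈ A} with hG1
  have hsub : G1 ⊆ G0 := fun g hg => hA.2.1 g hg
  have hatom : ∀ U, IsMinZeroSum G1 U → IsMinZeroSum G0 U := fun U hU =>
    ⟨hU.1, fun g hg => hsub (hU.2.1 g hg), hU.2.2⟩
  have hA1 : IsMinZeroSum G1 A := ⟨hA.1, fun g hg => hg, hA.2.2⟩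
  have hlen1 : ∀ (B : Multiset G) (k l : ℕ), k ∈ lengthSet G1 B →
      l ∈ lengthSet G1 B → (d : ℤ) ∣ (k : ℤ) - l := by
    rintro B k l ⟨U, hU, hB⟩ ⟨V, hV, hB'⟩
    exact hlen B k l ⟨U, fun i => hatom _ (hU i), hB⟩ ⟨V, fun i => hatom _ (hV i), hB'⟩
  obtain ⟨τ, hτ, hτ0⟩ := exists_tau G1 n d hn hd (by omega) hlen1
  have hlcn : ∀ U, IsMinZeroSum G1 U → n ≤ kapM n U := by
    intro U hU
    by_contra hcon
    push Not at hcon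
    have hnod := small_atom hn2 hn hd hnd τ hτ hτ0 hU hcon
    have hle : U ≤ A := (Multiset.le_iff_subset hnod).2 (fun g hg => hU.2.1 g hg)
    rcases hA.2.2.2 U hle hU.2.2.1 with h | h
    · exact hU.1 h
    · subst h; omega
  have hAz : IsZeroSumSeq G1 A := ⟨hA1.2.1, hA1.2.2.1⟩
  have hcA := cvec_mem_Lam hAz
  have h0 := tau_zero hpk hn hd f hf i0 hf0 τ hτ hτ0 hlcn _ (cvec A) le_rfl
    (AddSubgroup.nsmul_mem _ hcA n1) hcA.1
  have h0' : n1 • τ ⟨cvec A, hcA⟩ = 0 := by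
    rw [← map_nsmul]; exact h0
  obtain ⟨t, ht, hτt⟩ := hτ A hAz 1 (lengthSet_atom hA1)
  rw [hτt] at h0'
  have hdvd : (n : ℤ) ∣ n1 * t := by
    rw [← ZMod.intCast_zmod_eq_zero_iff_dvd]
    push_cast
    simpa using h0'
  have hb := atom_bound (r := d + 1) hpk (by omega) (by omega) f hf hA
  have hbz : (kapM n A : ℤ) < n * (d + 1) := by exact_mod_cast hb
  obtain ⟨s, hs⟩ := hdvd
  have hdz : (0 : ℤ) < d := by exact_mod_cast hd
  have hnz : (0 : ℤ) < n := by omega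
  have hn1z : (0 : ℤ) < n1 := by exact_mod_cast hn1
  have htn : t < n := by
    have : (d : ℤ) * t < d * n := by rw [← ht]; push_cast; linarith
    exact lt_of_mul_lt_mul_left this hdz.le
  have hsn : s < n1 := by
    have : (n : ℤ) * s < n * n1 := by rw [← hs]; nlinarith
    exact lt_of_mul_lt_mul_left this hnz.le
  have hfin : (n1 : ℤ) * kapM n A ≤ n * (n1 + (n1 - 1) * d) := by
    have e : (n1 : ℤ) * kapM n A = n * n1 + n * (d * s) := by
      linear_combination (n1 : ℤ) * ht + d * hs
    have h9 : (d : ℤ) * s ≤ d * (n1 - 1) := mul_le_mul_of_nonneg_left (by omega) hdz.le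
    have := mul_le_mul_of_nonneg_left h9 hnz.le
    rw [e]; nlinarith
  have e : ((n1 - 1 : ℕ) : ℤ) = n1 - 1 := by omega
  zify
  rw [e]
  exact hfin

end Dep

section Lower

variable {G : Type*} [AddCommGroup G] [Fintype G]

theorem lengthSet_nsmul {G0 : Set G} {B : Multiset G} {k : ℕ} (hk : k ∈ lengthSet G0 B) (j : ℕ) :
    j * k ∈ lengthSet G0 (j • B) := by
  induction j with
  | zero => simpa using lengthSet_zero G0
  | succ j ih =>
    rw [succ_nsmul, Nat.succ_mul]
    exact lengthSet_add ih hk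

theorem lengthSet_sum {G0 : Set G} {ι : Type*} (s : Finset ι) (B : ι → Multiset G) (k : ι → ℕ)
    (hk : ∀ i ∈ s, k i ∈ lengthSet G0 (B i)) : ∑ i ∈ s, k i ∈ lengthSet G0 (∑ i ∈ s, B i) := by
  induction s using Finset.induction_on with
  | empty => simpa using lengthSet_zero G0
  | insert a s ha ih =>
    rw [Finset.sum_insert ha, Finset.sum_insert ha]
    exact lengthSet_add (hk a (Finset.mem_insert_self _ _))
      (ih fun i hi => hk i (Finset.mem_insert_of_mem hi))

theorem mk_of_supp {ι : Type*} [Fintype ι] (h : ι → G) (hinj : Function.Injective h)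
    (B : Multiset G) (hB : ∀ g ∈ B, g ∈ Set.range h) :
    B = ∑ o, B.count (h o) • {h o} := by
  ext g
  rw [Multiset.count_sum']
  by_cases hg : g ∈ Set.range h
  · obtain ⟨o, rfl⟩ := hg
    rw [Finset.sum_eq_single o]
    · simp
    · intro b _ hb
      have : h o ≠ h b := fun hh => hb (hinj hh).symm
      simp [Multiset.count_singleton, this]
    · simp
  · rw [Multiset.count_eq_zero_of_notMem (fun hh => hg (hB g hh))]
    symm
    apply Finset.sum_eq_zero
    intro b _
    have : g ≠ h b := fun hh => hg ⟨b, hh.symm⟩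
    simp [Multiset.count_singleton, this]

theorem lower_exists {d m : ℕ} (hd : 0 < d) (hm : 1 < m) (e : Fin (d + 1) → G)
    (he : ∀ c : Fin (d + 1) → ℤ, ∑ i, c i • e i = 0 ↔ ∀ i, (m : ℤ) ∣ c i) :
    ∃ G0 : Set G, deltaG0 G0 ≠ ∅ ∧ d ∣ sInf (deltaG0 G0) ∧ ∃ A, IsMinZeroSum G0 A ∧
      crossNum A = 1 + ((m : ℝ) - 1) * d / m := by
  have hm1 : ¬ (m : ℤ) ∣ 1 := by
    intro h
    have := Int.le_of_dvd one_pos h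
    omega
  let e0 : G := ∑ i, e i
  let h : Option (Fin (d + 1)) → G := fun o => o.elim e0 e
  have hdiff : ∀ c c' : Fin (d + 1) → ℤ, ∑ i, c i • e i = ∑ i, c' i • e i →
      ∀ i, (m : ℤ) ∣ c i - c' i := by
    intro c c' hc
    apply (he (fun i => c i - c' i)).1
    simp [sub_smul, hc]
  have hsing : ∀ i, e i = ∑ j, (if j = i then (1 : ℤ) else 0) • e j := by
    intro i; simp [ite_smul]
  have hone : e0 = ∑ j, (1 : ℤ) • e j := by simp [e0]
  have hne0 : ∀ i, e0 ≠ e i := by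
    intro i hi
    rw [hone, hsing i] at hi
    have := hdiff _ _ hi
    obtain ⟨j, hj⟩ : ∃ j : Fin (d + 1), j ≠ i := by
      have : Nontrivial (Fin (d + 1)) := Fin.nontrivial_iff_two_le.2 (by omega)
      exact exists_ne i
    have := this j
    simp [hj] at this
    exact hm1 (by exact_mod_cast this)
  have hinj : Function.Injective h := by
    intro o o' hoo
    cases o with
    | none => cases o' with
      | none => rfl
      | some j => exact absurd hoo (hne0 j)
    | some i => cases o' with
      | none => exact absurd hoo.symm (hne0 i)
      | some j =>
        have hij : e i = e j := hoo
        by_contra hne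
        have hne : i ≠ j := fun hh => hne (by rw [hh])
        rw [hsing i, hsing j] at hij
        have := hdiff _ _ hij i
        simp [hne] at this
        exact hm1 (by exact_mod_cast this)
  have hord : ∀ o, addOrderOf (h o) = m := by
    intro o
    apply Nat.dvd_right_iff_eq.1 
    intro k
    rw [addOrderOf_dvd_iff_nsmul_eq_zero]
    cases o with
    | none =>
      have : k • h none = ∑ i, (k : ℤ) • e i := by simp [h, e0, Finset.smul_sum]
      rw [this, he]
      constructor
      · intro hh; exact_mod_cast hh 0
      · intro hh i; exact_mod_cast hh
    | some j =>
      have : k • h (some j) = ∑ i, (if i = j then (k : ℤ) else 0) • e i := by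
        simp [h, ite_smul]
      rw [this, he]
      constructor
      · intro hh; have := hh j; simp at this; exact_mod_cast this
      · intro hh i
        split_ifs
        · exact_mod_cast hh
        · simp
  set G0 : Set G := Set.range h with hG0
  have hsum : ∀ B : Multiset G, (∀ g ∈ B, g ∈ G0) → (B.sum = 0 ↔
      ∀ i, m ∣ B.count e0 + B.count (e i)) := by
    intro B hB
    have h1 := congrArg Multiset.sum (mk_of_supp h hinj B hB)
    rw [Fintype.sum_option, Multiset.sum_add] at h1
    have h2 : B.sum = ∑ i, ((B.count e0 : ℤ) + B.count (e i)) • e i := by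
      rw [h1]
      simp only [add_smul, Finset.sum_add_distrib]
      congr 1
      · simp [h, e0, Finset.smul_sum, Multiset.sum_nsmul]
      · rw [← Multiset.coe_sumAddMonoidHom, map_sum]; simp [h, Multiset.sum_nsmul]
    rw [h2, he]
    exact forall_congr' fun i => by exact_mod_cast Iff.rfl
  have hcard : ∀ B : Multiset G, (∀ g ∈ B, g ∈ G0) → 
      Multiset.card B = B.count e0 + ∑ i, B.count (e i) := by
    intro B hB
    have h1 := congrArg Multiset.card (mk_of_supp h hinj B hB)
    rw [Fintype.sum_option] at h1
    simpa [h] using h1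
  have heq : ∀ B C : Multiset G, (∀ g ∈ B, g ∈ G0) → (∀ g ∈ C, g ∈ G0) →
      B.count e0 = C.count e0 → (∀ i, B.count (e i) = C.count (e i)) → B = C := by
    intro B C hB hC h0 h1
    rw [mk_of_supp h hinj B hB, mk_of_supp h hinj C hC]
    apply Finset.sum_congr rfl
    intro o _
    cases o with
    | none => rw [show h none = e0 from rfl, h0]
    | some i => rw [show h (some i) = e i from rfl, h1]
  have hatom : ∀ o, IsMinZeroSum G0 (Multiset.replicate m (h o)) := by
    intro o
    have := atom_replicate (G0 := G0) (g := h o) ⟨o, rfl⟩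
    rwa [hord] at this
  have hbig : ∀ B : Multiset G, IsMinZeroSum G0 B → ∀ o, m ≤ B.count (h o) →
      B = Multiset.replicate m (h o) := by
    intro B hB o ho
    rcases hB.2.2.2 _ (Multiset.le_count_iff_replicate_le.1 ho) (hatom o).2.2.1 with h1 | h1
    · exact absurd h1 (hatom o).1
    · exact h1.symm
  have hval : ∀ B : Multiset G, IsMinZeroSum G0 B →
      ((m * d : ℕ) : ℤ) ∣ Multiset.card B + d * B.count e0 - m := by
    intro B hB
    by_cases h0 : m ≤ B.count (h none)
    · have := hbig B hB none h0
      rw [this, show h none = e0 from rfl]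
      simp
      rw [mul_comm]
    by_cases h1 : ∃ i, m ≤ B.count (h (some i))
    · obtain ⟨i, hi⟩ := h1
      have := hbig B hB _ hi
      rw [this]
      have h2 : ¬ e0 = e i := hne0 i
      have h3 : ¬ e i = e0 := fun h => hne0 i h.symm
      simp [h, Multiset.count_replicate, h3]
    push Not at h0 h1
    have hz := (hsum B hB.2.1).1 hB.2.2.1
    change B.count e0 < m at h0
    change ∀ i, B.count (e i) < m at h1
    by_cases ha : B.count e0 = 0
    · exfalso
      apply hB.1
      apply heq B 0 hB.2.1 (by simp) (by simpa using ha)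
      intro i
      have := hz i
      rw [ha, zero_add] at this
      simpa using Nat.eq_zero_of_dvd_of_lt this (h1 i)
    · have hb : ∀ i, (B.count (e i) : ℤ) = m - B.count e0 := by
        intro i
        obtain ⟨q, hq⟩ := hz i
        have := h1 i
        have hq1 : q = 1 := by
          have hq0 : q ≠ 0 := by rintro rfl; omega
          have : q < 2 := by
            by_contra hcon
            have : m * 2 ≤ m * q := Nat.mul_le_mul_left _ (by omega)
            omega
          omega
        rw [hq1] at hq
        omega
      rw [hcard B hB.2.1]
      push_cast
      rw [Finset.sum_congr rfl (fun i _ => hb i)]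
      simp
      refine ⟨1, ?_⟩
      ring
  have hlen : ∀ (B : Multiset G) (k l : ℕ), k ∈ lengthSet G0 B → l ∈ lengthSet G0 B →
      (d : ℤ) ∣ (k : ℤ) - l := by
    have hk : ∀ (B : Multiset G) (k : ℕ), k ∈ lengthSet G0 B →
        ((m * d : ℕ) : ℤ) ∣ Multiset.card B + d * B.count e0 - m * k := by
      rintro B k ⟨U, hU, rfl⟩
      rw [Multiset.count_sum', Multiset.card_sum]
      have : ((∑ i, Multiset.card (U i) : ℕ) : ℤ) + d * (∑ i, (U i).count e0 : ℕ) - m * k =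
          ∑ i, ((Multiset.card (U i) : ℤ) + d * (U i).count e0 - m) := by
        simp [Finset.sum_add_distrib, Finset.mul_sum, mul_comm]
      rw [this]
      exact Finset.dvd_sum fun i _ => hval _ (hU i)
    intro B k l h1 h2
    have := dvd_sub (hk B l h2) (hk B k h1)
    have h3 : (m : ℤ) * d ∣ m * (k - l) := by
      have h4 : (m : ℤ) * ((k : ℤ) - l) = ((Multiset.card B : ℤ) + d * B.count e0 - m * l) -
          ((Multiset.card B : ℤ) + d * B.count e0 - m * k) := by ring
      rw [h4]
      exact_mod_cast this
    exact (mul_dvd_mul_iff_left (by omega)).1 h3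
  let v : Multiset G := {e0} + ∑ i, (m - 1) • {e i}
  have hei : ∀ i j, e i = e j ↔ i = j := fun i j =>
    ⟨fun hh => Option.some_injective _ (hinj (a₁ := some i) (a₂ := some j) hh), fun hh => by rw [hh]⟩
  have hv0 : v.count e0 = 1 := by
    simp only [v, Multiset.count_add, Multiset.count_sum']
    simp [Multiset.count_singleton, hne0]
  have hv1 : ∀ i, v.count (e i) = m - 1 := by
    intro i
    simp only [v, Multiset.count_add, Multiset.count_sum']
    simp [Multiset.count_singleton, (hne0 i).symm, hei]
  have hvG : ∀ g ∈ v, g ∈ G0 := by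
    intro g hg
    simp only [v, Multiset.mem_add, Multiset.mem_sum, Multiset.mem_singleton] at hg
    rcases hg with hg | ⟨i, -, hi⟩
    · exact ⟨none, hg.symm⟩
    · have := Multiset.mem_of_mem_nsmul hi
      exact ⟨some i, (Multiset.mem_singleton.1 this).symm⟩
  have hvA : IsMinZeroSum G0 v := by
    refine ⟨?_, hvG, ?_, ?_⟩
    · intro h0; rw [h0] at hv0; simp at hv0
    · rw [hsum v hvG]
      intro i
      rw [hv0, hv1, Nat.add_sub_cancel' hm.le]
    · intro T hT hT0
      have hTG : ∀ g ∈ T, g ∈ G0 := fun g hg => hvG g (Multiset.mem_of_le hT hg)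
      have hz := (hsum T hTG).1 hT0
      have hc0 := Multiset.count_le_of_le e0 hT
      have hc1 := fun i => Multiset.count_le_of_le (e i) hT
      rw [hv0] at hc0
      rcases Nat.eq_zero_or_pos (T.count e0) with h0 | h0
      · left
        apply heq T 0 hTG (by simp) (by simpa using h0)
        intro i
        have h1 := hz i
        have h2 := hc1 i
        rw [h0, zero_add] at h1
        rw [hv1] at h2
        simpa using Nat.eq_zero_of_dvd_of_lt h1 (by omega)
      · right
        have h0 : T.count e0 = 1 := by omega
        apply heq T v hTG hvG (by omega)
        intro i
        have h1 := hz i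
        have h2 := hc1 i
        rw [hv1] at h2 ⊢
        have := Nat.le_of_dvd (by omega) h1
        omega
  have hne : deltaG0 G0 ≠ ∅ := by
    have hl1 := lengthSet_nsmul (lengthSet_atom hvA) m
    have hl2 : 1 + ∑ i : Fin (d + 1), (m - 1) * 1 ∈ lengthSet G0 (Multiset.replicate m (h none) +
        ∑ i, (m - 1) • Multiset.replicate m (h (some i))) :=
      lengthSet_add (lengthSet_atom (hatom none))
        (lengthSet_sum _ _ _ fun i _ => lengthSet_nsmul (lengthSet_atom (hatom (some i))) _)
    have hveq : Multiset.replicate m (h none) +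
        ∑ i, (m - 1) • Multiset.replicate m (h (some i)) = m • v := by
      simp only [v, smul_add, Finset.smul_sum]
      congr 1
      · rw [Multiset.nsmul_singleton]; rfl
      · apply Finset.sum_congr rfl
        intro i _
        rw [smul_comm, Multiset.nsmul_singleton]; rfl
    rw [hveq] at hl2
    refine delta_nonempty G0 (m • v) _ _ ?_ hl1 hl2
    obtain ⟨q, rfl⟩ : ∃ q, m = q + 2 := ⟨m - 2, by omega⟩
    simp
    nlinarith
  refine ⟨G0, hne, dvd_sInf_delta G0 d hne hlen, v, hvA, ?_⟩
  have hcr : crossNum v = Multiset.card v * (1 / (m : ℝ)) := by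
    rw [crossNum, Multiset.map_congr rfl (g := fun _ => 1 / (m : ℝ))]
    · simp
    · intro g hg
      obtain ⟨o, rfl⟩ := hvG g hg
      rw [hord]
  have hm0 : (m : ℝ) ≠ 0 := by positivity
  rw [hcr, hcard v hvG, hv0, Finset.sum_congr rfl (fun i _ => hv1 i)]
  simp
  rw [Nat.cast_sub hm.le]
  field_simp
  push_cast
  ring

end Lower

section Final

theorem exists_embed {a N : ℕ} (hN : 0 < N) (haN : a ∣ N) :
    ∃ φ : ZMod a →+ ZMod N, Function.Injective φ := by
  obtain ⟨q, rfl⟩ := haN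
  have hq : 0 < q := Nat.pos_of_mul_pos_left hN
  have key : ∀ z : ℤ, z • ((q : ℕ) : ZMod (a * q)) = 0 ↔ (a : ℤ) ∣ z := by
    intro z
    have : z • ((q : ℕ) : ZMod (a * q)) = ((z * q : ℤ) : ZMod (a * q)) := by simp
    rw [this, ZMod.intCast_zmod_eq_zero_iff_dvd]
    push_cast
    exact mul_dvd_mul_iff_right (by omega)
  refine ⟨ZMod.lift a ⟨zmultiplesHom _ ((q : ℕ) : ZMod (a * q)), ?_⟩, ?_⟩
  · rw [zmultiplesHom_apply, key]
  · rw [ZMod.lift_injective]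
    intro z hz
    rw [zmultiplesHom_apply, key] at hz
    rwa [ZMod.intCast_zmod_eq_zero_iff_dvd]

theorem crossNum_eq {G : Type*} [AddCommGroup G] [Fintype G] {n : ℕ} (hn0 : 0 < n)
    (hn : ∀ g : G, addOrderOf g ∣ n)
    (A : Multiset G) : crossNum A = (kapM n A : ℝ) / n := by
  induction A using Multiset.induction_on with
  | empty => simp [crossNum, kapM]
  | cons g A ih =>
    have h1 : crossNum (g ::ₘ A) = 1 / (addOrderOf g : ℝ) + crossNum A := by simp [crossNum]
    have h2 : kapM n (g ::ₘ A) = n / addOrderOf g + kapM n A := by simp [kapM]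
    have h0 : (addOrderOf g : ℝ) ≠ 0 := by exact_mod_cast (addOrderOf_pos g).ne'
    have h3 : (n : ℝ) ≠ 0 := by exact_mod_cast hn0.ne'
    rw [h1, h2, ih]
    push_cast
    rw [Nat.cast_div (hn g) h0]
    field_simp

theorem main_aux {G : Type*} [AddCommGroup G] [Fintype G]
    (d : ℕ) (n : Fin (d + 1) → ℕ) (hn : ∀ i, 1 < n i) (N : ℕ)
    (hdvd0 : ∀ i : Fin (d + 1), n 0 ∣ n i) (hdvdN : ∀ i : Fin (d + 1), n i ∣ N)
    (E : G ≃+ (∀ i : Fin (d + 1), ZMod (n i)))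
    (hN2 : 2 ≤ N) (hbig : N / 2 ≤ d) (hpp : IsPrimePow N) :
    KGd G d = 1 + ((n 0 : ℝ) - 1) * d / (n 0 : ℝ) := by
  have hd : 0 < d := by omega
  have hm := hn 0
  obtain ⟨p, k, hp, -, hpk⟩ := hpp
  have hp' : p.Prime := hp.nat_prime
  haveI : Fact p.Prime := ⟨hp'⟩
  choose φ hφ using fun i => exists_embed (show 0 < N by omega) (hdvdN i)
  let f : G →+ (Fin (d + 1) → ZMod N) :=
    { toFun := fun g i => φ i (E g i)
      map_zero' := by ext i; simp
      map_add' := by intro a b; ext i; simp }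
  have hf : Function.Injective f := by
    intro a b hab
    apply E.injective
    ext i
    exact hφ i (congrFun hab i)
  have hf0 : ∀ g, f (n 0 • g) 0 = 0 := by
    intro g
    change φ 0 (E (n 0 • g) 0) = 0
    rw [map_nsmul]
    simp
  have hord : ∀ g : G, addOrderOf g ∣ N := by
    intro g
    rw [addOrderOf_dvd_iff_nsmul_eq_zero]
    apply hf
    rw [map_nsmul, map_zero]
    ext i; simp
  have hm0 : (0 : ℝ) < n 0 := by exact_mod_cast (by omega : 0 < n 0)
  have hNpos : (0 : ℝ) < N := by exact_mod_cast (by omega : 0 < N)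
  have hc0 : (0 : ℝ) ≤ 1 + ((n 0 : ℝ) - 1) * d / (n 0 : ℝ) := by
    have : (1 : ℝ) ≤ n 0 := by exact_mod_cast hm.le
    have : 0 ≤ (n 0 : ℝ) - 1 := by linarith
    positivity
  have hupA : ∀ G0 : Set G, deltaG0 G0 ≠ ∅ → d ∣ sInf (deltaG0 G0) → ∀ A, IsMinZeroSum G0 A →
      crossNum A ≤ 1 + ((n 0 : ℝ) - 1) * d / (n 0 : ℝ) := by
    intro G0 h1 h2 A hA
    have h3 := upper_int (G0 := G0) (n1 := n 0) hpk.symm hN2 hd hbig (by omega) (hdvdN 0) f hf 0 hf0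
      (fun B k l hk hl => minDelta_dvd G0 d h2 h1 B k l hk hl) hA
    rw [crossNum_eq (by omega) hord A, div_le_iff₀ hNpos]
    have h4 : ((n 0 * kapM N A : ℕ) : ℝ) ≤ ((N * (n 0 + (n 0 - 1) * d) : ℕ) : ℝ) := by
      exact_mod_cast h3
    push_cast [Nat.cast_sub hm.le] at h4
    have h5 : (1 + ((n 0 : ℝ) - 1) * d / (n 0 : ℝ)) * N =
        (N * (n 0 + ((n 0 : ℝ) - 1) * d)) / n 0 := by field_simp
    rw [h5, le_div_iff₀ hm0]
    linarith
  have hupK : ∀ G0 : Set G, deltaG0 G0 ≠ ∅ → d ∣ sInf (deltaG0 G0) →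
      KG0 G0 ≤ 1 + ((n 0 : ℝ) - 1) * d / (n 0 : ℝ) := by
    intro G0 h1 h2
    apply Real.sSup_le _ hc0
    rintro x ⟨A, hA, rfl⟩
    exact hupA G0 h1 h2 A hA
  apply le_antisymm
  · apply Real.sSup_le _ hc0
    rintro x ⟨G0, h1, h2, rfl⟩
    exact hupK G0 h1 h2
  · let e : Fin (d + 1) → G := fun i => E.symm (Pi.single i ((n i / n 0 : ℕ) : ZMod (n i)))
    have he : ∀ c : Fin (d + 1) → ℤ, ∑ i, c i • e i = 0 ↔ ∀ i, (n 0 : ℤ) ∣ c i := by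
      intro c
      have h1 : ∑ i, c i • e i =
          E.symm (fun i => ((c i * (n i / n 0 : ℕ) : ℤ) : ZMod (n i))) := by
        simp only [e, ← map_zsmul, ← map_sum]
        congr 1
        ext i
        rw [Finset.sum_apply, Finset.sum_eq_single i]
        · rw [Pi.smul_apply, Pi.single_eq_same, Int.cast_mul, Int.cast_natCast, zsmul_eq_mul]
        · intro j _ hj
          simp [Pi.single_eq_of_ne hj.symm]
        · simp
      rw [h1, map_eq_zero_iff _ E.symm.injective, funext_iff]
      refine forall_congr' fun i => ?_
      change ((c i * (n i / n 0 : ℕ) : ℤ) : ZMod (n i)) = 0 ↔ _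
      rw [ZMod.intCast_zmod_eq_zero_iff_dvd]
      obtain ⟨q, hq⟩ := hdvd0 i
      have hni := hn i
      have hq0 : q ≠ 0 := by rintro rfl; omega
      rw [hq, Nat.mul_div_cancel_left _ (by omega)]
      push_cast
      exact mul_dvd_mul_iff_right (by exact_mod_cast hq0)
    obtain ⟨G0, h1, h2, A, hA, hcr⟩ := lower_exists hd hm e he
    rw [← hcr]
    have h3 : crossNum A ≤ KG0 G0 := by
      apply le_csSup
      · refine ⟨1 + ((n 0 : ℝ) - 1) * d / (n 0 : ℝ), ?_⟩
        rintro x ⟨A, hA, rfl⟩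
        exact hupA G0 h1 h2 A hA
      · exact ⟨A, hA, rfl⟩
    refine h3.trans ?_
    apply le_csSup
    · refine ⟨1 + ((n 0 : ℝ) - 1) * d / (n 0 : ℝ), ?_⟩
      rintro x ⟨G0, h1, h2, rfl⟩
      exact hupK G0 h1 h2
    · exact ⟨G0, h1, h2, rfl⟩

end Final

/-- Suppose `G ≅ C_{n₁} ⊕ … ⊕ C_{n_r}` with `1 < n₁ ∣ … ∣ n_r`,
`D(G) ≥ 4` and `r ≥ ⌊n_r/2⌋ + 1`. If `n_r` is a prime power, then
`K(G, r−1) = 1 + (n₁ − 1)(r−1)/n₁ < r`. -/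
theorem stmt11 {G : Type*} [AddCommGroup G] [Fintype G]
    (r : ℕ) (hr : 0 < r) (n : Fin r → ℕ) (hn : ∀ i, 1 < n i)
    (hdvd : ∀ i j : Fin r, i ≤ j → n i ∣ n j)
    (hG : Nonempty (G ≃+ (∀ i : Fin r, ZMod (n i))))
    (hD : 4 ≤ davenport G)
    (hbig : n ⟨r - 1, by omega⟩ / 2 + 1 ≤ r) (hpp : IsPrimePow (n ⟨r - 1, by omega⟩)) :
    KGd G (r - 1) = 1 + ((n ⟨0, hr⟩ : ℝ) - 1) * ((r : ℝ) - 1) / (n ⟨0, hr⟩ : ℝ) ∧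
    KGd G (r - 1) < (r : ℝ) := by
  obtain ⟨d, rfl⟩ : ∃ d, r = d + 1 := ⟨r - 1, by omega⟩
  obtain ⟨E⟩ := hG
  have hN2 := hn ⟨d + 1 - 1, by omega⟩
  have hmain := main_aux d n hn (n ⟨d + 1 - 1, by omega⟩)
    (fun i => hdvd 0 i (Fin.zero_le i))
    (fun i => hdvd _ _ (by rw [Fin.le_def]; have := i.isLt; simp; omega)) E hN2 (by omega) hpp
  have h0 : (⟨0, hr⟩ : Fin (d + 1)) = 0 := rfl
  have hd : 0 < d := by omega
  rw [h0, Nat.add_sub_cancel, hmain]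
  have hm0 : (1 : ℝ) < n 0 := by exact_mod_cast hn 0
  have hd0 : (0 : ℝ) < d := by exact_mod_cast hd
  push_cast
  refine ⟨by ring, ?_⟩
  have : ((n 0 : ℝ) - 1) * d / (n 0 : ℝ) < d := by
    rw [div_lt_iff₀ (by linarith)]
    nlinarith
  linarith
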